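/- arXiv:1707.07944 — 2 statements merged into one kernel-verified Lean document; each statement's English description precedes it below -/
import Mathlib

section
/- Let k be a commutative ring, A and B small additive categories, Φ : A → B an additive functor, Φ_* : (A, Mod_k) → (B, Mod_k) the left Kan extension along Φ between the categories of all functors to k-modules, and L_i(Φ_*) its left derived functors (the category (A, Mod_k) has enough projectives). Then for every d ≥ 0 there is a graded isomorphism cr_d^B ∘ L_•(Φ_*) ≅ L_•((Φ^{×d})_*) ∘ cr_d^A of functors (A, Mod_k) → (B^d, Mod_k), natural in the argument, where Φ^{×d} : A^d → B^d denotes the functor (a_1,…,a_d) ↦ (Φ(a_1),…,Φ(a_d)). -/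
open CategoryTheory CategoryTheory.Limits
universe u
variable {A : Type u} [SmallCategory A] [Preadditive A] [HasFiniteBiproducts A]
variable {k : Type u} [CommRing k]

noncomputable def deleteSummand {d : ℕ} (x : Fin d → A) (i : Fin d) :
    (⨁ x) ⟶ ⨁ fun j : {j : Fin d // j ≠ i} => x j.1 :=
  biproduct.lift fun j => biproduct.π x j.1

lemma deleteSummand_natural {d : ℕ} {x y : Fin d → A} (f : ∀ i, x i ⟶ y i) (i : Fin d) :
    biproduct.map f ≫ deleteSummand y i =
      deleteSummand x i ≫ biproduct.map fun j : {j : Fin d // j ≠ i} => f j.1 := by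
  ext j
  simp [deleteSummand]

lemma biproduct_map_pi_id {d : ℕ} (x : Fin d → A) :
    biproduct.map (𝟙 x : ∀ i, x i ⟶ x i) = 𝟙 (⨁ x) := by
  ext j
  simp [CategoryTheory.Pi.id_apply]

noncomputable def crComparison {d : ℕ} (F : A ⥤ ModuleCat.{u} k) (x : Fin d → A) :
    F.obj (⨁ x) ⟶ ⨁ fun i : Fin d => F.obj (⨁ fun j : {j : Fin d // j ≠ i} => x j.1) :=
  biproduct.lift fun i => F.map (deleteSummand x i)

lemma crComparison_natural₁ {d : ℕ} (F : A ⥤ ModuleCat.{u} k) {x y : Fin d → A}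
    (f : ∀ i, x i ⟶ y i) :
    F.map (biproduct.map f) ≫ crComparison F y =
      crComparison F x ≫
        biproduct.map fun i => F.map (biproduct.map fun j : {j : Fin d // j ≠ i} => f j.1) := by
  ext i
  simp only [crComparison, Category.assoc, biproduct.lift_π, biproduct.map_π,
    biproduct.lift_π_assoc, ← F.map_comp, deleteSummand_natural]

noncomputable def crossEffectObj (d : ℕ) (F : A ⥤ ModuleCat.{u} k) :
    (Fin d → A) ⥤ ModuleCat.{u} k where
  obj x := kernel (crComparison F x)
  map {x y} f := kernel.map (crComparison F x) (crComparison F y)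
    (F.map (biproduct.map f))
    (biproduct.map fun i => F.map (biproduct.map fun j : {j : Fin d // j ≠ i} => f j.1))
    (crComparison_natural₁ F f).symm
  map_id x := by
    rw [← cancel_mono (kernel.ι (crComparison F x))]
    simp only [kernel.lift_ι, Category.id_comp]
    rw [biproduct_map_pi_id, F.map_id, Category.comp_id]
  map_comp {x y z} f g := by
    rw [← cancel_mono (kernel.ι (crComparison F z))]
    simp only [kernel.lift_ι, kernel.lift_ι_assoc, Category.assoc]
    have : biproduct.map (f ≫ g : ∀ i, x i ⟶ z i) = biproduct.map f ≫ biproduct.map g := by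
      ext j
      simp [CategoryTheory.Pi.comp_apply]
    rw [this, F.map_comp]

lemma crComparison_natural₂ {d : ℕ} {F G : A ⥤ ModuleCat.{u} k} (α : F ⟶ G) (x : Fin d → A) :
    α.app (⨁ x) ≫ crComparison G x =
      crComparison F x ≫
        biproduct.map fun i => α.app (⨁ fun j : {j : Fin d // j ≠ i} => x j.1) := by
  ext i
  simp [crComparison, α.naturality]

noncomputable def crossEffectMap {d : ℕ} {F G : A ⥤ ModuleCat.{u} k} (α : F ⟶ G) :
    crossEffectObj d F ⟶ crossEffectObj d G where
  app x := kernel.map (crComparison F x) (crComparison G x) (α.app (⨁ x))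
    (biproduct.map fun i => α.app (⨁ fun j : {j : Fin d // j ≠ i} => x j.1))
    (crComparison_natural₂ α x).symm
  naturality {x y} f := by
    dsimp [crossEffectObj]
    rw [← cancel_mono (kernel.ι (crComparison G y))]
    simp only [kernel.lift_ι, kernel.lift_ι_assoc, Category.assoc]
    rw [α.naturality]

noncomputable def crossEffect (d : ℕ) :
    (A ⥤ ModuleCat.{u} k) ⥤ ((Fin d → A) ⥤ ModuleCat.{u} k) where
  obj F := crossEffectObj d F
  map α := crossEffectMap α
  map_id F := by
    ext x : 2
    dsimp [crossEffectMap, crossEffectObj]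
    rw [← cancel_mono (kernel.ι (crComparison F x))]
    simp only [kernel.lift_ι, Category.id_comp, Category.comp_id, NatTrans.id_app]
  map_comp {F G H} α β := by
    ext x : 2
    dsimp [crossEffectMap, crossEffectObj]
    rw [← cancel_mono (kernel.ι (crComparison H x))]
    simp only [NatTrans.comp_app, kernel.lift_ι, kernel.lift_ι_assoc, Category.assoc]

section generic
universe v₁ v₂ v₃ v₄ u₁ u₂ u₃ u₄
variable {C : Type u₁} [Category.{v₁} C] [Abelian C] [EnoughProjectives C]
  {D : Type u₂} [Category.{v₂} D] [Abelian D]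
  {C' : Type u₃} [Category.{v₃} C'] [Abelian C'] [EnoughProjectives C']
  {D' : Type u₄} [Category.{v₄} D'] [Abelian D']

noncomputable def homologyMapIso' (E : D ⥤ D') [E.Additive] [E.PreservesHomology] (n : ℕ) :
   HomologicalComplex.homologyFunctor D (ComplexShape.down ℕ) n ⋙ E ≅
     E.mapHomologicalComplex _ ⋙ HomologicalComplex.homologyFunctor D' (ComplexShape.down ℕ) n :=
  NatIso.ofComponents (fun K => ((K.sc n).mapHomologyIso E).symm)
    (fun {K L} f => by
      exact (ShortComplex.mapHomologyIso_inv_naturality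
        ((HomologicalComplex.shortComplexFunctor D (ComplexShape.down ℕ) n).map f) E))

lemma chain_comm {X : Type u₁} [Category.{v₁} X] {a₀ a₁ a₂ a₃ a₄ b₀ b₁ b₂ b₃ b₄ : X}
    {a : a₀ ⟶ a₁} {b : a₁ ⟶ a₂} {c : a₂ ⟶ a₃} {d : a₃ ⟶ a₄}
    {a' : b₀ ⟶ b₁} {b' : b₁ ⟶ b₂} {c' : b₂ ⟶ b₃} {d' : b₃ ⟶ b₄}
    {f₀ : a₀ ⟶ b₀} {f₁ : a₁ ⟶ b₁} {f₂ : a₂ ⟶ b₂} {f₃ : a₃ ⟶ b₃} {f₄ : a₄ ⟶ b₄}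
    (h₁ : f₀ ≫ a' = a ≫ f₁) (h₂ : f₁ ≫ b' = b ≫ f₂) (h₃ : f₂ ≫ c' = c ≫ f₃)
    (h₄ : f₃ ≫ d' = d ≫ f₄) :
    f₀ ≫ a' ≫ b' ≫ c' ≫ d' = (a ≫ b ≫ c ≫ d) ≫ f₄ := by
  rw [← Category.assoc f₀, h₁, Category.assoc, ← Category.assoc f₁, h₂, Category.assoc,
    ← Category.assoc f₂, h₃, Category.assoc, h₄]
  simp only [Category.assoc]

lemma comm_map_aux {X X' : Type*} [Category X] [Category X'] (E : X ⥤ X')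
    {p q x y : X} {φ : p ⟶ q} {πq : q ⟶ y} {πp : p ⟶ x} {f : x ⟶ y} {u : E.obj x ⟶ E.obj x}
    {v : E.obj y ⟶ E.obj y}
    (hu : u = 𝟙 _) (hv : v = 𝟙 _) (h : φ ≫ πq = πp ≫ f) :
    E.map φ ≫ E.map πq ≫ v = (E.map πp ≫ u) ≫ E.map f := by
  subst hu hv
  simp only [Category.comp_id, ← E.map_comp, h]

noncomputable def leftDerivedCompIso (L : C ⥤ D) [L.Additive] (L' : C' ⥤ D') [L'.Additive]
    (E : C ⥤ C') [E.Additive] [E.PreservesHomology] (hE : ∀ P, Projective P → Projective (E.obj P))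
    (E' : D ⥤ D') [E'.Additive] [E'.PreservesHomology]
    (e : L ⋙ E' ≅ E ⋙ L') (n : ℕ) : L.leftDerived n ⋙ E' ≅ E ⋙ L'.leftDerived n := by
  haveI : E.PreservesProjectiveObjects := ⟨fun {P} h => hE P h⟩
  let eh := NatIso.mapHomologicalComplex e (ComplexShape.down ℕ)
  refine NatIso.ofComponents (fun X => 
    E'.mapIso ((projectiveResolution X).isoLeftDerivedObj L n) ≪≫
    (homologyMapIso' E' n).app _ ≪≫
    (HomologicalComplex.homologyFunctor D' (ComplexShape.down ℕ) n).mapIso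
      (eh.app (projectiveResolution X).complex) ≪≫
    ((E.mapProjectiveResolution (projectiveResolution X)).isoLeftDerivedObj L' n).symm) ?_
  intro X Y f
  let φ := ProjectiveResolution.lift f (projectiveResolution X) (projectiveResolution Y)
  have comm : φ.f 0 ≫ (projectiveResolution Y).π.f 0 = (projectiveResolution X).π.f 0 ≫ f :=
    ProjectiveResolution.lift_commutes_zero _ _ _
  have h1 := ProjectiveResolution.isoLeftDerivedObj_hom_naturality f (projectiveResolution X)
    (projectiveResolution Y) φ comm L n
  have h2 := ProjectiveResolution.isoLeftDerivedObj_inv_naturality (E.map f)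
    (E.mapProjectiveResolution (projectiveResolution X))
    (E.mapProjectiveResolution (projectiveResolution Y))
    ((E.mapHomologicalComplex _).map φ) (comm_map_aux E (by simp) (by simp) comm) L' n
  have h3 := (homologyMapIso' E' n).hom.naturality ((L.mapHomologicalComplex _).map φ)
  have h4 := (congrArg (HomologicalComplex.homologyFunctor D' (ComplexShape.down ℕ) n).map
    (eh.hom.naturality φ))
  rw [Functor.map_comp, Functor.map_comp] at h4
  have h1' := congrArg E'.map h1
  rw [Functor.map_comp, Functor.map_comp] at h1'
  exact chain_comm h1' h3 h4 h2.symm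
end generic

section retractGeneric
universe v₁ v₂ u₁ u₂
variable {C : Type u₁} [Category.{v₁} C] {D : Type u₂} [Category.{v₂} D]

/-- Images of conjugate idempotents are isomorphic. -/
def isoOfRetracts {F F' T T' : C ⥤ D} (i : F ⟶ T) (p : T ⟶ F) (hip : i ≫ p = 𝟙 F)
    (i' : F' ⟶ T') (p' : T' ⟶ F') (hip' : i' ≫ p' = 𝟙 F') (θ : T ≅ T')
    (h : (p ≫ i) ≫ θ.hom = θ.hom ≫ p' ≫ i') : F ≅ F' where
  hom := i ≫ θ.hom ≫ p'
  inv := i' ≫ θ.inv ≫ p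
  hom_inv_id := by
    have h1 : θ.hom ≫ p' ≫ i' ≫ θ.inv = p ≫ i := by
      rw [← Category.assoc p', ← Category.assoc θ.hom, ← h]; simp
    calc _ = i ≫ (θ.hom ≫ p' ≫ i' ≫ θ.inv) ≫ p := by simp
      _ = _ := by rw [h1]; simp only [Category.assoc, hip, Category.comp_id]
  inv_hom_id := by
    have h1 : θ.inv ≫ p ≫ i ≫ θ.hom = p' ≫ i' := by
      rw [Iso.inv_comp_eq, ← h, Category.assoc]
    calc _ = i' ≫ (θ.inv ≫ p ≫ i ≫ θ.hom) ≫ p' := by simp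
      _ = _ := by rw [h1]; simp only [Category.assoc, hip', Category.comp_id]

lemma preservesHomology_of_retract [Abelian C] [Abelian D] {F T : C ⥤ D} [F.Additive] [T.Additive]
    [T.PreservesHomology] (i : F ⟶ T) (p : T ⟶ F) (hip : i ≫ p = 𝟙 F) : F.PreservesHomology := by
  refine ((Functor.exact_tfae F).out 1 2).mp ?_
  intro S hS
  have hT : (S.map T).Exact := hS.map T
  rw [ShortComplex.exact_iff_isZero_homology] at hT ⊢
  rw [IsZero.iff_id_eq_zero] at hT ⊢
  have h1 : S.mapNatTrans i ≫ S.mapNatTrans p = 𝟙 (S.map F) := by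
    ext
    · exact congr_app hip S.X₁
    · exact congr_app hip S.X₂
    · exact congr_app hip S.X₃
  rw [← ShortComplex.homologyMap_id, ← h1, ShortComplex.homologyMap_comp,
    ← Category.id_comp (ShortComplex.homologyMap (S.mapNatTrans p)), hT]
  simp
end retractGeneric

section cr
variable {d : ℕ}

variable (A d) in
noncomputable def sumF : (Fin d → A) ⥤ A where
  obj x := ⨁ x
  map f := biproduct.map f
  map_id x := biproduct_map_pi_id x
  map_comp f g := by
    ext j
    simp [CategoryTheory.Pi.comp_apply]

variable (A d) in
def diagF : A ⥤ (Fin d → A) where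
  obj a := fun _ => a
  map f := fun _ => f

variable (A d) in
noncomputable def diagSumAdj : diagF A d ⊣ sumF A d :=
  Adjunction.mkOfHomEquiv
    { homEquiv := fun a x =>
        { toFun := fun f => biproduct.lift f
          invFun := fun g i => g ≫ biproduct.π x i
          left_inv := fun f => by funext i; exact biproduct.lift_π _ _
          right_inv := fun g => by
            apply biproduct.hom_ext
            intro i
            exact biproduct.lift_π _ _ }
      homEquiv_naturality_left_symm := by
        intro a b x f g
        funext i
        exact Category.assoc f g (biproduct.π x i)
      homEquiv_naturality_right := by
        intro a x y f g
        apply biproduct.hom_ext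
        intro i
        have h1 : biproduct.lift (f ≫ g) ≫ biproduct.π y i = f i ≫ g i := biproduct.lift_π _ _
        have h2 : (biproduct.lift f ≫ biproduct.map g) ≫ biproduct.π y i = f i ≫ g i := by
          have h3 : biproduct.lift f ≫ biproduct.π x i = f i := biproduct.lift_π _ _
          rw [Category.assoc, biproduct.map_π, ← Category.assoc]
          exact congrArg (· ≫ g i) h3
        exact h1.trans h2.symm }

variable (A k d) in
/-- precomposition with the direct sum functor -/
noncomputable abbrev sumPre : (A ⥤ ModuleCat.{u} k) ⥤ ((Fin d → A) ⥤ ModuleCat.{u} k) :=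
  (Functor.whiskeringLeft _ _ _).obj (sumF A d)

open Classical in
/-- Zeroing the coordinates in `I`. -/
noncomputable def zeroing (I : Finset (Fin d)) (x : Fin d → A) : x ⟶ x :=
  fun i => if i ∈ I then 0 else 𝟙 (x i)

lemma zeroing_natural (I : Finset (Fin d)) {x y : Fin d → A} (f : x ⟶ y) :
    f ≫ zeroing I y = zeroing I x ≫ f := by
  funext i
  simp only [zeroing, CategoryTheory.Pi.comp_apply]
  split_ifs <;> simp

lemma zeroing_empty (x : Fin d → A) : zeroing ∅ x = 𝟙 x := by
  funext i
  simp [zeroing]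

/-- The action of `zeroing` on a functor. -/
noncomputable def zeroingNat (I : Finset (Fin d)) (G : (Fin d → A) ⥤ ModuleCat.{u} k) : G ⟶ G where
  app x := G.map (zeroing I x)
  naturality x y f := by rw [← G.map_comp, ← G.map_comp, zeroing_natural]

noncomputable def rho (G : (Fin d → A) ⥤ ModuleCat.{u} k) : G ⟶ G :=
  ∑ I : Finset (Fin d), (-1 : ℤ) ^ I.card • zeroingNat I G

lemma zeroingNat_naturality (I : Finset (Fin d)) {G H : (Fin d → A) ⥤ ModuleCat.{u} k}
    (f : G ⟶ H) : f ≫ zeroingNat I H = zeroingNat I G ≫ f := by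
  ext x : 2
  exact (f.naturality (zeroing I x)).symm

lemma rho_naturality {G H : (Fin d → A) ⥤ ModuleCat.{u} k}
    (f : G ⟶ H) : f ≫ rho H = rho G ≫ f := by
  simp only [rho, Preadditive.comp_sum, Preadditive.sum_comp, Preadditive.comp_zsmul,
    Preadditive.zsmul_comp, zeroingNat_naturality]

lemma rho_app (G : (Fin d → A) ⥤ ModuleCat.{u} k) (x : Fin d → A) :
    (rho G).app x = ∑ I : Finset (Fin d), (-1 : ℤ) ^ I.card • G.map (zeroing I x) := by
  rw [rho, NatTrans.app_sum]
  rfl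

lemma map_zeroing_deleteSummand_congr (I J : Finset (Fin d)) (i : Fin d)
    (h : ∀ j, j ≠ i → (j ∈ I ↔ j ∈ J)) (x : Fin d → A) :
    biproduct.map (zeroing I x) ≫ deleteSummand x i =
      biproduct.map (zeroing J x) ≫ deleteSummand x i := by
  dsimp only [deleteSummand]
  ext j : 1
  simp only [Category.assoc, biproduct.lift_π, biproduct.map_π, zeroing]
  simp only [h j.1 j.2]

lemma map_zeroing_factors (I : Finset (Fin d)) (i : Fin d) (hi : i ∈ I) (x : Fin d → A) :
    ∃ g, biproduct.map (zeroing I x) = deleteSummand x i ≫ g := by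
  classical
  refine ⟨biproduct.lift (fun b => if h : b = i then 0 else
    biproduct.π (fun j : {j : Fin d // j ≠ i} => x j.1) ⟨b, h⟩ ≫ zeroing I x b), ?_⟩
  ext1 b
  rw [biproduct.map_π, Category.assoc, biproduct.lift_π]
  split_ifs with h
  · subst h
    simp [zeroing, hi]
  · rw [deleteSummand, biproduct.lift_π_assoc]

noncomputable def rhoF (F : A ⥤ ModuleCat.{u} k) (x : Fin d → A) : F.obj (⨁ x) ⟶ F.obj (⨁ x) :=
  ∑ I : Finset (Fin d), (-1 : ℤ) ^ I.card • F.map (biproduct.map (zeroing I x))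

lemma rho_eq_rhoF (F : A ⥤ ModuleCat.{u} k) (x : Fin d → A) :
    (rho ((sumPre A k d).obj F)).app x = rhoF F x := rho_app _ _

lemma rhoF_natural₁ (F : A ⥤ ModuleCat.{u} k) {x y : Fin d → A} (f : x ⟶ y) :
    F.map (biproduct.map f) ≫ rhoF F y = rhoF F x ≫ F.map (biproduct.map f) := by
  have h := (rho ((sumPre A k d).obj F)).naturality f
  rw [rho_eq_rhoF, rho_eq_rhoF] at h
  exact h

lemma rhoF_natural₂ {F G : A ⥤ ModuleCat.{u} k} (α : F ⟶ G) (x : Fin d → A) :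
    α.app (⨁ x) ≫ rhoF G x = rhoF F x ≫ α.app (⨁ x) := by
  have h := congr_app (rho_naturality ((sumPre A k d).map α)) x
  rw [NatTrans.comp_app, NatTrans.comp_app, rho_eq_rhoF, rho_eq_rhoF] at h
  exact h

lemma rhoF_deleteSummand (F : A ⥤ ModuleCat.{u} k) (x : Fin d → A) (i : Fin d) :
    rhoF F x ≫ F.map (deleteSummand x i) = 0 := by
  classical
  rw [rhoF, Preadditive.sum_comp]
  refine Finset.sum_involution (fun I _ => symmDiff I {i}) ?_ ?_ ?_ ?_
  · intro I _
    have h : F.map (biproduct.map (zeroing I x)) ≫ F.map (deleteSummand x i) =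
        F.map (biproduct.map (zeroing (symmDiff I {i}) x)) ≫ F.map (deleteSummand x i) := by
      rw [← F.map_comp, ← F.map_comp,
        map_zeroing_deleteSummand_congr I (symmDiff I {i}) i (by
          intro j hj; simp [Finset.mem_symmDiff, hj])]
    have hc : (-1 : ℤ) ^ (symmDiff I {i}).card = - (-1 : ℤ) ^ I.card := by
      by_cases hi : i ∈ I
      · have : symmDiff I {i} = I.erase i := by
          ext j; by_cases hj : j = i
          · subst hj; simp [Finset.mem_symmDiff, hi]
          · simp [Finset.mem_symmDiff, hj]
        rw [this, ← Finset.card_erase_add_one hi, pow_succ]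
        simp
      · have : symmDiff I {i} = insert i I := by
          ext j; by_cases hj : j = i
          · subst hj; simp [Finset.mem_symmDiff, hi]
          · simp [Finset.mem_symmDiff, hj]
        rw [this, Finset.card_insert_of_notMem hi, pow_succ]
        simp
    rw [Preadditive.zsmul_comp, Preadditive.zsmul_comp, hc, h]
    simp
  · intro I _ _ h
    have := congrArg (fun J => i ∈ J) h
    simp [Finset.mem_symmDiff] at this
  · intro I _; simp
  · intro I _; simp

variable (A k d) in
noncomputable def crι : crossEffect (A := A) (k := k) d ⟶ sumPre A k d where
  app F :=
    { app := fun x => kernel.ι (crComparison F x)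
      naturality := fun x y f => kernel.lift_ι _ _ _ }
  naturality F G α := by
    ext x : 2
    exact kernel.lift_ι _ _ _

lemma rhoF_crComparison (F : A ⥤ ModuleCat.{u} k) (x : Fin d → A) :
    rhoF F x ≫ crComparison F x = 0 := by
  rw [crComparison]
  ext1 i
  rw [Category.assoc, biproduct.lift_π, rhoF_deleteSummand, zero_comp]

variable (A k d) in
noncomputable def crp : sumPre A k d ⟶ crossEffect (A := A) (k := k) d where
  app F :=
    { app := fun x => kernel.lift (crComparison F x) (rhoF F x) (rhoF_crComparison F x)
      naturality := fun x y f => by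
        have h := rhoF_natural₁ F f
        change F.map (biproduct.map f) ≫ kernel.lift (crComparison F y) (rhoF F y) _ =
          kernel.lift (crComparison F x) (rhoF F x) _ ≫ kernel.map _ _ _ _ (crComparison_natural₁ F f).symm
        rw [← cancel_mono (kernel.ι (crComparison F y))]
        simp only [kernel.lift_ι, kernel.lift_ι_assoc, Category.assoc]
        exact h }
  naturality F G α := by
    ext x : 2
    have h := rhoF_natural₂ α x
    change α.app (⨁ x) ≫ kernel.lift (crComparison G x) (rhoF G x) _ =
          kernel.lift (crComparison F x) (rhoF F x) _ ≫ kernel.map _ _ _ _ (crComparison_natural₂ α x).symm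
    rw [← cancel_mono (kernel.ι (crComparison G x))]
    simp only [kernel.lift_ι, kernel.lift_ι_assoc, Category.assoc]
    exact h

lemma crp_crι (F : A ⥤ ModuleCat.{u} k) :
    (crp A k d).app F ≫ (crι A k d).app F = rho ((sumPre A k d).obj F) := by
  ext x : 2
  rw [rho_eq_rhoF]
  exact kernel.lift_ι _ _ _

lemma kernel_ι_zeroing (F : A ⥤ ModuleCat.{u} k) (x : Fin d → A) (I : Finset (Fin d))
    (hI : I ≠ ∅) : kernel.ι (crComparison F x) ≫ F.map (biproduct.map (zeroing I x)) = 0 := by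
  obtain ⟨i, hi⟩ := Finset.nonempty_iff_ne_empty.mpr hI
  obtain ⟨g, hg⟩ := map_zeroing_factors I i hi x
  have h : crComparison F x ≫ biproduct.π _ i = F.map (deleteSummand x i) := biproduct.lift_π _ _
  rw [hg, F.map_comp, ← h, Category.assoc, kernel.condition_assoc, zero_comp]

lemma kernel_ι_rhoF (F : A ⥤ ModuleCat.{u} k) (x : Fin d → A) :
    kernel.ι (crComparison F x) ≫ rhoF F x = kernel.ι (crComparison F x) := by
  rw [rhoF, Preadditive.comp_sum, Finset.sum_eq_single ∅]
  · rw [zeroing_empty, biproduct_map_pi_id]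
    simp
  · intro I _ hI
    rw [Preadditive.comp_zsmul, kernel_ι_zeroing F x I hI, smul_zero]
  · simp

lemma crι_crp : crι A k d ≫ crp A k d = 𝟙 _ := by
  ext F x : 4
  change kernel.ι (crComparison F x) ≫ kernel.lift (crComparison F x) (rhoF F x) _ = 𝟙 _
  rw [← cancel_mono (kernel.ι (crComparison F x)), Category.assoc, kernel.lift_ι,
    kernel_ι_rhoF, Category.id_comp]

instance : (sumPre A k d).Additive where
instance : (crossEffect (A := A) (k := k) d).Additive where
  map_add {F G f g} := by
    have := (crι A k d).naturality
    have hm : ∀ X, Mono ((crι A k d).app X) := fun X => 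
      mono_of_mono_fac (congr_app (crι_crp (A := A) (k := k) (d := d)) X)
    rw [← cancel_mono ((crι A k d).app G)]
    simp only [Preadditive.add_comp, (crι A k d).naturality, Functor.map_add, Preadditive.comp_add]

instance : (sumPre A k d).PreservesHomology := inferInstance

instance : (crossEffect (A := A) (k := k) d).PreservesHomology :=
  preservesHomology_of_retract (crι A k d) (crp A k d) crι_crp

lemma crossEffect_projective (F : A ⥤ ModuleCat.{u} k) (hF : Projective F) :
    Projective ((crossEffect (A := A) (k := k) d).obj F) := by
  have h : Projective ((sumPre A k d).obj F) :=
    ((diagSumAdj A d).whiskerLeft (ModuleCat.{u} k)).map_projective F hF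
  exact Retract.projective (Y := (sumPre A k d).obj F)
    ⟨(crι A k d).app F, (crp A k d).app F, congr_app crι_crp F⟩

variable {B : Type u} [SmallCategory B] [Preadditive B] [HasFiniteBiproducts B]
    (Φ : A ⥤ B) [Φ.Additive]

lemma pi_map_zeroing (I : Finset (Fin d)) (x : Fin d → A) :
    (Functor.pi fun _ : Fin d => Φ).map (zeroing I x) = zeroing I _ := by
  funext i
  change Φ.map (zeroing I x i) = zeroing I (fun j => Φ.obj (x j)) i
  simp only [zeroing]
  split_ifs <;> simp

variable [∀ F : (Fin d → A) ⥤ ModuleCat.{u} k,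
      (Functor.pi fun _ : Fin d => Φ).HasLeftKanExtension F]

lemma lan_map_zeroingNat (I : Finset (Fin d)) (G : (Fin d → A) ⥤ ModuleCat.{u} k) :
    (Functor.pi fun _ : Fin d => Φ).lan.map (zeroingNat I G) = zeroingNat I _ := by
  apply ((Functor.pi fun _ : Fin d => Φ).lanAdjunction (ModuleCat.{u} k)).homEquiv _ _ |>.injective
  rw [Adjunction.homEquiv_unit, Adjunction.homEquiv_unit, Adjunction.unit_naturality]
  ext x : 2
  have h := (((Functor.pi fun _ : Fin d => Φ).lanAdjunction (ModuleCat.{u} k)).unit.app G).naturality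
    (zeroing I x)
  refine Eq.trans h ?_
  rw [NatTrans.comp_app]
  congr 1
  dsimp [zeroingNat]
  rw [pi_map_zeroing]

lemma lan_map_rho [((Functor.pi fun _ : Fin d => Φ).lan :
        ((Fin d → A) ⥤ ModuleCat.{u} k) ⥤ ((Fin d → B) ⥤ ModuleCat.{u} k)).Additive]
    (G : (Fin d → A) ⥤ ModuleCat.{u} k) :
    (Functor.pi fun _ : Fin d => Φ).lan.map (rho G) = rho _ := by
  simp only [rho, Functor.map_sum, Functor.map_zsmul, lan_map_zeroingNat]

variable [∀ F : A ⥤ ModuleCat.{u} k, Φ.HasLeftKanExtension F]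

variable (k d) in
noncomputable def lanSumIso : (Φ.lan : (A ⥤ ModuleCat.{u} k) ⥤ _) ⋙ sumPre B k d ≅
    sumPre A k d ⋙ (Functor.pi fun _ : Fin d => Φ).lan :=
  Adjunction.leftAdjointUniq
    ((Φ.lanAdjunction (ModuleCat.{u} k)).comp ((diagSumAdj B d).whiskerLeft (ModuleCat.{u} k)))
    ((((diagSumAdj A d).whiskerLeft (ModuleCat.{u} k)).comp
      ((Functor.pi fun _ : Fin d => Φ).lanAdjunction (ModuleCat.{u} k))).ofNatIsoRight
      (Iso.refl _))

variable (k d) in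
noncomputable def lanCrIso [((Functor.pi fun _ : Fin d => Φ).lan :
        ((Fin d → A) ⥤ ModuleCat.{u} k) ⥤ ((Fin d → B) ⥤ ModuleCat.{u} k)).Additive] :
    (Φ.lan : (A ⥤ ModuleCat.{u} k) ⥤ _) ⋙ crossEffect d ≅
      crossEffect d ⋙ (Functor.pi fun _ : Fin d => Φ).lan :=
  isoOfRetracts
    (Functor.whiskerLeft _ (crι B k d)) (Functor.whiskerLeft _ (crp B k d))
    (by rw [← Functor.whiskerLeft_comp, crι_crp, Functor.whiskerLeft_id'])
    (Functor.whiskerRight (crι A k d) _) (Functor.whiskerRight (crp A k d) _)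
    (by rw [← Functor.whiskerRight_comp, crι_crp, Functor.whiskerRight_id'])
    (lanSumIso k d Φ)
    (by
      ext F : 2
      have h := crp_crι (d := d) (Φ.lan.obj F)
      have h' := crp_crι (d := d) F
      simp only [NatTrans.comp_app, Functor.whiskerLeft_app, Functor.whiskerRight_app]
      rw [h, ← Functor.map_comp, h', lan_map_rho]
      exact (rho_naturality _).symm)
end cr

/-- Statement 10: for every degree `n`, the `d`-th cross-effect of the `n`-th left derived
functor of the left Kan extension along `Φ` is naturally isomorphic to the `n`-th left derived
functor of the left Kan extension along `Φ^{×d}` applied to the `d`-th cross-effect. -/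
theorem crossEffect_leftDerived_lan_iso
    {B : Type u} [SmallCategory B] [Preadditive B] [HasFiniteBiproducts B]
    (Φ : A ⥤ B) [Φ.Additive] (d : ℕ)
    [∀ F : A ⥤ ModuleCat.{u} k, Φ.HasLeftKanExtension F]
    [∀ F : (Fin d → A) ⥤ ModuleCat.{u} k,
      (Functor.pi fun _ : Fin d => Φ).HasLeftKanExtension F]
    [EnoughProjectives (A ⥤ ModuleCat.{u} k)]
    [EnoughProjectives ((Fin d → A) ⥤ ModuleCat.{u} k)]
    [(Φ.lan : (A ⥤ ModuleCat.{u} k) ⥤ (B ⥤ ModuleCat.{u} k)).Additive]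
    [((Functor.pi fun _ : Fin d => Φ).lan :
        ((Fin d → A) ⥤ ModuleCat.{u} k) ⥤ ((Fin d → B) ⥤ ModuleCat.{u} k)).Additive]
    (n : ℕ) :
    Nonempty
      (((Φ.lan : (A ⥤ ModuleCat.{u} k) ⥤ (B ⥤ ModuleCat.{u} k)).leftDerived n ⋙
          crossEffect d) ≅
        (crossEffect d ⋙
          ((Functor.pi fun _ : Fin d => Φ).lan :
            ((Fin d → A) ⥤ ModuleCat.{u} k) ⥤ ((Fin d → B) ⥤ ModuleCat.{u} k)).leftDerived n)) := by
  exact ⟨leftDerivedCompIso _ _ (crossEffect d) (fun F hF => crossEffect_projective F hF) (crossEffect d)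
    (lanCrIso k d Φ) n⟩
end

section
/- For every n ≥ 0, let IA_n denote the kernel of the group homomorphism Aut(F_n) → GL_n(ℤ) induced by abelianization, where F_n is the free group of rank n (using the canonical isomorphism between the abelianization of F_n and ℤ^n). Then the first integral homology group H_1(IA_n; ℤ), i.e. the abelianization of IA_n, is isomorphic to the abelian group Hom_ℤ(ℤ^n, Λ²(ℤ^n)) of ℤ-linear maps from ℤ^n to the second exterior power of ℤ^n. -/
/-!
Statement 15: `H_1(IA_n; ℤ)`, i.e. the abelianization of the group `IA_n` (the kernel of
`Aut(F_n) → GL_n(ℤ)` induced by abelianization), is isomorphic to `Hom_ℤ(ℤ^n, Λ²(ℤ^n))`.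
-/

open Abelianization

/-- The group homomorphism `Aut(F_n) → Aut(F_n^{ab})` induced by abelianization.
Through the canonical isomorphism `F_n^{ab} ≅ ℤ^n`, this is the canonical homomorphism
`Aut(F_n) → GL_n(ℤ)`. -/
def autToAutAbelianization (n : ℕ) :
    MulAut (FreeGroup (Fin n)) →* MulAut (Abelianization (FreeGroup (Fin n))) where
  toFun e := e.abelianizationCongr
  map_one' := by
    ext x
    refine QuotientGroup.induction_on x fun g => ?_
    show (MulEquiv.abelianizationCongr 1) (Abelianization.of g) = Abelianization.of g
    simp [abelianizationCongr_of]
  map_mul' e₁ e₂ := by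
    ext x
    refine QuotientGroup.induction_on x fun g => ?_
    show (MulEquiv.abelianizationCongr (e₁ * e₂)) (Abelianization.of g) =
      (MulEquiv.abelianizationCongr e₁) ((MulEquiv.abelianizationCongr e₂) (Abelianization.of g))
    simp [abelianizationCongr_of, MulAut.mul_apply]

/-- `IA_n` : the kernel of the homomorphism `Aut(F_n) → GL_n(ℤ)` induced by abelianization
(identified with the kernel of `Aut(F_n) → Aut(F_n^{ab})` via the canonical isomorphism
between the abelianization of `F_n` and `ℤ^n`). -/
def IA (n : ℕ) : Subgroup (MulAut (FreeGroup (Fin n))) :=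
  (autToAutAbelianization n).ker


set_option linter.unusedSectionVars false
set_option linter.unusedVariables false

/-- Data of a group with elementary generators and signed permutations acting on `ℤ^ι`. -/
structure GLData (ι : Type) [DecidableEq ι] (G : Type) [Group G] where
  ρ : G →* Equiv.Perm (ι → ℤ)
  E : ι → ι → ℤ → G
  W : Subgroup G
  E_add : ∀ {i j}, i ≠ j → ∀ a b, E i j (a + b) = E i j a * E i j b
  ρE : ∀ {i j}, i ≠ j → ∀ a v, ρ (E i j a) v = Function.update v j (v j + a * v i)
  comm : ∀ {i j k l}, i ≠ j → k ≠ l → j ≠ k → i ≠ l → ∀ a b, E i j a * E k l b = E k l b * E i j a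
  chain : ∀ {i j l}, i ≠ j → j ≠ l → i ≠ l → ∀ a b,
    E j l b * E i j a = E i j a * E i l (a * b) * E j l b
  rot : ∀ {i j}, i ≠ j → E j i 1 * E i j (-1) * E j i 1 ∈ W
  flip : ∀ i, ∃ w ∈ W, ∀ v, ρ w v = Function.update v i (- v i)
  hW : ∀ w ∈ W, ∃ σ : Equiv.Perm ι, ∃ ε : ι → ℤ, (∀ i, ε i * ε i = 1) ∧
    (∀ v i, ρ w v (σ i) = ε i * v i) ∧
    ∀ i j a, i ≠ j → w * E i j a = E (σ i) (σ j) (ε i * ε j * a) * w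
  injW : ∀ w ∈ W, ρ w = 1 → w = 1

namespace GLData

variable {ι : Type} [DecidableEq ι] [Fintype ι] {G : Type} [Group G] (D : GLData ι G)

def nrm (v : ι → ℤ) : ℕ := ∑ i, (v i).natAbs

lemma nrm_congr {v w : ι → ℤ} (h : v = w) : nrm v = nrm w := by rw [h]

lemma nrm_update (v : ι → ℤ) (j : ι) (x : ℤ) :
    nrm (Function.update v j x) + (v j).natAbs = nrm v + x.natAbs := by
  unfold nrm
  rw [← Finset.add_sum_erase _ _ (Finset.mem_univ j),
    ← Finset.add_sum_erase (s := Finset.univ) (f := fun i => (v i).natAbs) (Finset.mem_univ j)]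
  have : ∑ x_1 ∈ Finset.univ.erase j, (Function.update v j x x_1).natAbs =
      ∑ x_1 ∈ Finset.univ.erase j, (v x_1).natAbs := by
    apply Finset.sum_congr rfl
    intro k hk
    rw [Function.update_of_ne (Finset.ne_of_mem_erase hk)]
  rw [this]; simp; omega

lemma nrm_E {i j} (h : i ≠ j) (a v) :
    nrm (D.ρ (D.E i j a) v) + (v j).natAbs = nrm v + (v j + a * v i).natAbs := by
  rw [D.ρE h, nrm_update]

lemma E_same {i j} (h : i ≠ j) (a v) : D.ρ (D.E i j a) v j = v j + a * v i := by
  rw [D.ρE h]; simp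

lemma E_ne {i j} (h : i ≠ j) (a v) {k} (hk : k ≠ j) : D.ρ (D.E i j a) v k = v k := by
  rw [D.ρE h]; simp [hk]

lemma E_zero {i j} (h : i ≠ j) : D.E i j 0 = 1 := by
  have := D.E_add h 0 0
  simpa using this

lemma E_neg_mul {i j} (h : i ≠ j) (a) : D.E i j (-a) * D.E i j a = 1 := by
  rw [← D.E_add h]; simp [D.E_zero h]

lemma E_mul_neg {i j} (h : i ≠ j) (a) : D.E i j a * D.E i j (-a) = 1 := by
  rw [← D.E_add h]; simp [D.E_zero h]

lemma E_inv {i j} (h : i ≠ j) (a) : (D.E i j a)⁻¹ = D.E i j (-a) :=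
  inv_eq_of_mul_eq_one_left (D.E_neg_mul h a)

lemma chain' {i j l} (hij : i ≠ j) (hjl : j ≠ l) (hil : i ≠ l) (a b : ℤ) :
    D.E i j a * D.E j l b = D.E j l b * (D.E i j a) * D.E i l (a * -b) := by
  have := D.chain hij hjl hil a (-b)
  rw [← D.E_inv hjl] at this
  rw [mul_assoc, ← inv_mul_eq_iff_eq_mul, ← mul_assoc, this]
  simp [mul_assoc]

def H (S : Finset ι) : Subgroup G :=
  Subgroup.closure ({g | ∃ i j a, i ∉ S ∧ i ≠ j ∧ g = D.E i j a} ∪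
    {w | w ∈ D.W ∧ ∀ s ∈ S, D.ρ w (Pi.single s 1) = Pi.single s 1})

lemma E_mem_H {S : Finset ι} {i j} (hi : i ∉ S) (h : i ≠ j) (a) : D.E i j a ∈ D.H S :=
  Subgroup.subset_closure (Or.inl ⟨i, j, a, hi, h, rfl⟩)

lemma W_mem_H {S : Finset ι} {w} (hw : w ∈ D.W)
    (h : ∀ s ∈ S, D.ρ w (Pi.single s 1) = Pi.single s 1) : w ∈ D.H S :=
  Subgroup.subset_closure (Or.inr ⟨hw, h⟩)

/-- signed permutations fixing `S` -/
def WS (S : Finset ι) (w : G) : Prop := w ∈ D.W ∧ ∀ s ∈ S, D.ρ w (Pi.single s 1) = Pi.single s 1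

lemma WS_spec {S : Finset ι} {w} (hw : D.WS S w) :
    ∃ σ : Equiv.Perm ι, ∃ ε : ι → ℤ, (∀ i, ε i = 1 ∨ ε i = -1) ∧
    (∀ v i, D.ρ w v (σ i) = ε i * v i) ∧
    (∀ i j a, i ≠ j → w * D.E i j a = D.E (σ i) (σ j) (ε i * ε j * a) * w) ∧
    (∀ s ∈ S, σ s = s ∧ ε s = 1) ∧ (∀ s, s ∉ S → σ s ∉ S) := by
  obtain ⟨σ, ε, h1, h2, h3⟩ := D.hW w hw.1
  have h4 : ∀ s ∈ S, σ s = s ∧ ε s = 1 := by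
    intro s hs
    have := hw.2 s hs
    have h5 := h2 (Pi.single s 1) s
    rw [this] at h5
    have : σ s = s := by
      by_contra hne
      rw [Pi.single_eq_of_ne hne] at h5
      simp at h5
      have := h1 s
      simp [← h5] at this
    refine ⟨this, ?_⟩
    rw [this] at h5
    simpa using h5.symm
  refine ⟨σ, ε, fun i => ?_, h2, h3, h4, ?_⟩
  · exact mul_self_eq_one_iff.mp (h1 i)
  · intro s hs hs'
    have := (h4 _ hs').1
    exact hs (by rw [σ.injective this] at hs'; exact hs')

inductive R (S : Finset ι) (t : ι) : (ι → ℤ) → G ⧸ D.H (insert t S) → Prop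
  | base (w : G) (hw : D.WS S w) : R S t (D.ρ w (Pi.single t 1)) (w • ((1 : G) : G ⧸ D.H (insert t S)))
  | step (v c i j a) (hi : i ∉ S) (hij : i ≠ j) (ha : a = 1 ∨ a = -1)
      (hv : nrm v < nrm (D.ρ (D.E i j a) v)) (h : R S t v c) :
      R S t (D.ρ (D.E i j a) v) (D.E i j a • c)

variable {D} {S : Finset ι} {t : ι}

def Prim (S : Finset ι) (v : ι → ℤ) : Prop := ∀ d : ℤ, (∀ i, i ∉ S → d ∣ v i) → IsUnit d

lemma Prim.E {v : ι → ℤ} (h : Prim S v) {i j} (hi : i ∉ S) (hij : i ≠ j) (a : ℤ) :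
    Prim S (D.ρ (D.E i j a) v) := by
  intro d hd
  apply h
  intro k hk
  have h1 := hd i hi
  rw [D.E_ne hij _ _ hij] at h1
  by_cases hkj : k = j
  · subst hkj
    have h2 := hd k hk
    rw [D.E_same hij] at h2
    exact (dvd_add_left (dvd_mul_of_dvd_right h1 a)).mp h2
  · have h2 := hd k hk
    rwa [D.E_ne hij _ _ hkj] at h2

lemma Prim.w {v : ι → ℤ} (h : Prim S v) {w} (hw : D.WS S w) : Prim S (D.ρ w v) := by
  obtain ⟨σ, ε, h1, h2, h3, h4, h5⟩ := D.WS_spec hw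
  intro d hd
  apply h
  intro k hk
  have := hd (σ k) (h5 k hk)
  rw [h2] at this
  rcases h1 k with h | h <;> simpa [h] using this

lemma nrm_w {v : ι → ℤ} {w} (hw : D.WS S w) : nrm (D.ρ w v) = nrm v := by
  obtain ⟨σ, ε, h1, h2, h3, h4, h5⟩ := D.WS_spec hw
  unfold nrm
  rw [← Equiv.sum_comp σ]
  apply Finset.sum_congr rfl
  intro k _
  rw [h2]
  rcases h1 k with h | h <;> simp [h]

lemma nrm_single (ht : t ∉ S) : nrm (Pi.single t (1:ℤ)) = 1 := by
  unfold nrm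
  rw [Finset.sum_eq_single t]
  · simp
  · intro b _ hb; simp [hb]
  · simp

lemma prim_single (ht : t ∉ S) : Prim S (Pi.single t (1:ℤ)) := by
  intro d hd
  have := hd t ht
  simp at this
  exact isUnit_of_dvd_one this

lemma R.prim (ht : t ∉ S) {v c} (h : D.R S t v c) : Prim S v := by
  induction h with
  | base w hw => exact (prim_single ht).w hw
  | step v c i j a hi hij ha hv h ih => exact ih.E hi hij a

lemma prim_pos {v : ι → ℤ} (h : Prim S v) : 0 < nrm v := by
  by_contra h0
  have h1 : nrm v = 0 := by omega
  unfold nrm at h1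
  rw [Finset.sum_eq_zero_iff] at h1
  have := h 0 (fun i _ => by have := h1 i (Finset.mem_univ i); simp at this; simp [this])
  simp at this

lemma WS.mul {w w'} (hw : D.WS S w) (hw' : D.WS S w') : D.WS S (w * w') := by
  refine ⟨D.W.mul_mem hw.1 hw'.1, fun s hs => ?_⟩
  rw [map_mul, Equiv.Perm.mul_apply, hw'.2 s hs, hw.2 s hs]

lemma R.w {v c} (h : D.R S t v c) {w} (hw : D.WS S w) : D.R S t (D.ρ w v) (w • c) := by
  induction h with
  | base w' hw' =>
    have := R.base (D := D) (t := t) (w * w') (hw.mul hw')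
    rwa [map_mul, Equiv.Perm.mul_apply, mul_smul] at this
  | step v c i j a hi hij ha hv h ih =>
    obtain ⟨σ, ε, h1, h2, h3, h4, h5⟩ := D.WS_spec hw
    rw [← mul_smul, ← Equiv.Perm.mul_apply, ← map_mul, h3 _ _ _ hij, map_mul,
      Equiv.Perm.mul_apply, mul_smul]
    refine R.step _ _ _ _ _ (h5 i hi) (fun e => hij (σ.injective e)) ?_ ?_ ih
    · rcases h1 i with h | h <;> rcases h1 j with h' | h' <;> rcases ha with rfl | rfl <;>
        simp [h, h']
    · rw [← Equiv.Perm.mul_apply, ← map_mul, ← h3 _ _ _ hij, map_mul,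
      Equiv.Perm.mul_apply, nrm_w hw, nrm_w hw]
      exact hv

/-- Every primitive vector is reachable, provided enough signed permutations exist. -/
lemma exists_descent {v : ι → ℤ} (h : Prim S v) (h1 : nrm v ≠ 1) :
    ∃ i j a, i ∉ S ∧ i ≠ j ∧ (a = 1 ∨ a = -1) ∧ nrm (D.ρ (D.E i j a) v) < nrm v := by
  have key : ∀ i j, i ∉ S → i ≠ j → v i ≠ 0 → (v i).natAbs ≤ (v j).natAbs →
      ∃ i j a, i ∉ S ∧ i ≠ j ∧ (a = 1 ∨ a = -1) ∧ nrm (D.ρ (D.E i j a) v) < nrm v := by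
    intro i j hi hij h0 hle
    have e1 := D.nrm_E hij 1 v
    have e2 := D.nrm_E hij (-1) v
    by_cases hs : nrm (D.ρ (D.E i j 1) v) < nrm v
    · exact ⟨i, j, 1, hi, hij, Or.inl rfl, hs⟩
    · refine ⟨i, j, -1, hi, hij, Or.inr rfl, ?_⟩
      omega
  have : ∃ i, i ∉ S ∧ v i ≠ 0 := by
    by_contra hc
    push Not at hc
    have := h 0 (fun i hi => by simp [hc i hi])
    simp at this
  obtain ⟨i, hi, hvi⟩ := this
  by_cases hc : ∃ j, j ∉ S ∧ v j ≠ 0 ∧ i ≠ j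
  · obtain ⟨j, hj, hvj, hij⟩ := hc
    rcases le_total (v i).natAbs (v j).natAbs with hle | hle
    · exact key i j hi hij hvi hle
    · exact key j i hj hij.symm hvj hle
  · push Not at hc
    have hu : IsUnit (v i) := by
      apply h
      intro k hk
      by_cases h0 : v k = 0
      · simp [h0]
      · rw [← hc k hk h0]
    have hu' : (v i).natAbs = 1 := Int.isUnit_iff_natAbs_eq.mp hu
    have : ∃ j, j ≠ i ∧ v j ≠ 0 := by
      by_contra hcc
      push Not at hcc
      apply h1
      unfold nrm
      rw [Finset.sum_eq_single i]
      · exact hu'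
      · intro b _ hb; simp [hcc b hb]
      · simp
    obtain ⟨j, hji, hvj⟩ := this
    exact key i j hi hji.symm hvi (by omega)

lemma nrm_one {v : ι → ℤ} (h : Prim S v) (h1 : nrm v = 1) : ∃ i, i ∉ S ∧ v i ≠ 0 ∧
    ∀ k, k ≠ i → v k = 0 := by
  have : ∃ i, i ∉ S ∧ v i ≠ 0 := by
    by_contra hc
    push Not at hc
    have := h 0 (fun i hi => by simp [hc i hi])
    simp at this
  obtain ⟨i, hi, hvi⟩ := this
  refine ⟨i, hi, hvi, fun k hk => ?_⟩
  unfold nrm at h1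
  rw [← Finset.add_sum_erase _ _ (Finset.mem_univ i)] at h1
  have h2 : ∑ x ∈ Finset.univ.erase i, (v x).natAbs = 0 := by omega
  rw [Finset.sum_eq_zero_iff] at h2
  simpa using h2 k (Finset.mem_erase.mpr ⟨hk, Finset.mem_univ k⟩)

lemma smul_coe (g h : G) : g • ((h : G) : G ⧸ D.H (insert t S)) = ((g * h : G) : G ⧸ D.H (insert t S)) := rfl

lemma R.zero (ht : t ∉ S) {v c} (h : D.R S t v c) : ∀ {i j}, i ∉ S → i ≠ j → ∀ a, v i = 0 →
    D.E i j a • c = c := by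
  induction h with
  | base w hw =>
    intro i j hi hij a h0
    obtain ⟨σ, ε, h1, h2, h3, h4, h5⟩ := D.WS_spec hw
    obtain ⟨i, rfl⟩ := σ.surjective i
    obtain ⟨j, rfl⟩ := σ.surjective j
    have hij' : i ≠ j := fun e => hij (by rw [e])
    rw [h2] at h0
    have hit : i ≠ t := by
      rintro rfl
      rcases h1 i with h | h <;> simp [h] at h0
    have hi' : i ∉ insert t S := by
      simp only [Finset.mem_insert, not_or]
      refine ⟨hit, fun hs => hi (by rw [(h4 i hs).1]; exact hs)⟩
    have h6 : D.E (σ i) (σ j) a * w = w * D.E i j (ε i * ε j * a) := by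
      rw [h3 _ _ _ hij']
      congr 2
      rcases h1 i with h | h <;> rcases h1 j with h' | h' <;> simp [h, h']
    rw [smul_coe, smul_coe, mul_one, h6]
    apply QuotientGroup.eq.mpr
    have := (D.H (insert t S)).inv_mem (D.E_mem_H hi' hij' (ε i * ε j * a))
    convert this using 1
    group
  | step v c k l b hk hkl hb hv h ih =>
    intro i j hi hij a h0
    have e := D.nrm_E hkl b v
    have hil : i ≠ l := by
      rintro rfl
      rw [D.E_same hkl] at h0
      rw [h0] at e
      simp at e
      omega
    have h0' : v i = 0 := by rwa [D.E_ne hkl _ _ hil] at h0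
    by_cases hjk : j = k
    · subst hjk
      rw [← mul_smul, D.chain' hij hkl hil a b, mul_smul, mul_smul, ih hi hil _ h0',
        ih hi hij _ h0']
    · rw [← mul_smul, D.comm hij hkl hjk hil, mul_smul, ih hi hij a h0']


lemma exists_base (ht : t ∉ S) {v : ι → ℤ} (h : Prim S v) (h1 : nrm v = 1) :
    ∃ w, D.WS S w ∧ D.ρ w (Pi.single t 1) = v := by
  obtain ⟨i, hi, hvi, h0⟩ := nrm_one h h1
  have hvi' : v i = 1 ∨ v i = -1 := by
    have : (v i).natAbs ≤ nrm v :=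
      Finset.single_le_sum (f := fun i => (v i).natAbs) (fun _ _ => Nat.zero_le _) (Finset.mem_univ i)
    omega
  have key : ∃ w, D.WS S w ∧ D.ρ w (Pi.single t 1) = Pi.single i 1 := by
    by_cases hit : i = t
    · subst hit
      exact ⟨1, ⟨D.W.one_mem, by simp⟩, by simp⟩
    · refine ⟨_, ⟨D.rot hit, ?_⟩, ?_⟩
      · intro s hs
        have hsi : i ≠ s := fun e => hi (e ▸ hs)
        have hst : t ≠ s := fun e => ht (e ▸ hs)
        simp only [map_mul, Equiv.Perm.mul_apply]
        rw [D.ρE (Ne.symm hit), D.ρE hit, D.ρE (Ne.symm hit)]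
        ext k
        simp only [Function.update_apply, Pi.single_apply]
        split_ifs <;> simp_all
      · simp only [map_mul, Equiv.Perm.mul_apply]
        rw [D.ρE (Ne.symm hit), D.ρE hit, D.ρE (Ne.symm hit)]
        ext k
        simp only [Function.update_apply, Pi.single_apply]
        split_ifs <;> simp_all
  obtain ⟨w, hw, hwi⟩ := key
  rcases hvi' with e | e
  · refine ⟨w, hw, ?_⟩
    rw [hwi]
    ext k
    by_cases hk : k = i
    · subst hk; simp [e]
    · simp [hk, h0 k hk]
  · obtain ⟨f, hf, hf'⟩ := D.flip i
    refine ⟨f * w, WS.mul ⟨hf, ?_⟩ hw, ?_⟩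
    · intro s hs
      have hsi : i ≠ s := fun e => hi (e ▸ hs)
      rw [hf']
      ext k
      simp only [Function.update_apply, Pi.single_apply]
      split_ifs <;> simp_all
    · rw [map_mul, Equiv.Perm.mul_apply, hwi, hf']
      ext k
      by_cases hk : k = i
      · subst hk; simp [e]
      · simp [hk, h0 k hk]

lemma R.exists (ht : t ∉ S) : ∀ (N : ℕ) (v : ι → ℤ), nrm v = N → Prim S v → ∃ c, D.R S t v c := by
  intro N
  induction N using Nat.strong_induction_on with
  | _ N ih =>
    intro v hN hv
    by_cases h1 : nrm v = 1
    · obtain ⟨w, hw, rfl⟩ := exists_base (D := D) ht hv h1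
      exact ⟨_, R.base w hw⟩
    · obtain ⟨i, j, a, hi, hij, ha, hlt⟩ := exists_descent (D := D) hv h1
      obtain ⟨c, hc⟩ := ih _ (hN ▸ hlt) _ rfl (hv.E hi hij a)
      have e : D.ρ (D.E i j (-a)) (D.ρ (D.E i j a) v) = v := by
        rw [← Equiv.Perm.mul_apply, ← map_mul, D.E_neg_mul hij]; simp
      have := R.step _ _ i j (-a) hi hij (by rcases ha with rfl | rfl <;> simp) (by rwa [e]) hc
      rw [e] at this
      exact ⟨_, this⟩

/-- going up a descending move -/
lemma R.up {v c i j a} (hi : i ∉ S) (hij : i ≠ j) (ha : a = 1 ∨ a = -1)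
    (hlt : nrm (D.ρ (D.E i j a) v) < nrm v) (hc : D.R S t (D.ρ (D.E i j a) v) (D.E i j a • c)) :
    D.R S t v c := by
  have e : D.ρ (D.E i j (-a)) (D.ρ (D.E i j a) v) = v := by
    rw [← Equiv.Perm.mul_apply, ← map_mul, D.E_neg_mul hij]; simp
  have := R.step _ _ i j (-a) hi hij (by rcases ha with rfl | rfl <;> simp) (by rwa [e]) hc
  rwa [e, ← mul_smul, D.E_neg_mul hij, one_smul] at this

/-- `v` has value `c` via the descending move `E i j a` -/
structure Dn (D : GLData ι G) (S : Finset ι) (t : ι) (v : ι → ℤ) (i j : ι) (a : ℤ)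
    (c : G ⧸ D.H (insert t S)) : Prop where
  hi : i ∉ S
  hij : i ≠ j
  ha : a = 1 ∨ a = -1
  hlt : nrm (D.ρ (D.E i j a) v) < nrm v
  hR : D.R S t (D.ρ (D.E i j a) v) (D.E i j a • c)

lemma R.cases_dn (ht : t ∉ S) {v c} (h : D.R S t v c) (h1 : nrm v ≠ 1) : ∃ i j a, Dn D S t v i j a c := by
  cases h with
  | base w hw => exact absurd (by rw [nrm_w hw, nrm_single ht]) h1
  | step v c i j a hi hij ha hv h =>
    have e : D.ρ (D.E i j (-a)) (D.ρ (D.E i j a) v) = v := by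
      rw [← Equiv.Perm.mul_apply, ← map_mul, D.E_neg_mul hij]; simp
    refine ⟨i, j, -a, hi, hij, by rcases ha with rfl | rfl <;> simp, by rwa [e], ?_⟩
    rwa [e, ← mul_smul, D.E_neg_mul hij, one_smul]

lemma R.base_uniq (ht : t ∉ S) {v c c'} (h1 : nrm v = 1) (h : D.R S t v c) (h' : D.R S t v c') : c = c' := by
  have key : ∀ {v c}, nrm v = 1 → D.R S t v c → ∃ w, D.WS S w ∧ v = D.ρ w (Pi.single t 1) ∧
      c = w • ((1 : G) : G ⧸ D.H (insert t S)) := by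
    intro v c h1 h
    cases h with
    | base w hw => exact ⟨w, hw, rfl, rfl⟩
    | step v c i j a hi hij ha hv h =>
      have := prim_pos (h.prim ht)
      omega
  obtain ⟨w, hw, e, rfl⟩ := key h1 h
  obtain ⟨w', hw', e', rfl⟩ := key h1 h'
  rw [smul_coe, smul_coe, mul_one, mul_one]
  apply QuotientGroup.eq.mpr
  have inv : ∀ {w v u}, D.ρ w v = u → D.ρ w⁻¹ u = v := by
    intro w v u e; rw [← e, ← Equiv.Perm.mul_apply, ← map_mul]; simp
  apply D.W_mem_H (D.W.mul_mem (D.W.inv_mem hw.1) hw'.1)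
  intro s hs
  rw [map_mul, Equiv.Perm.mul_apply]
  rcases Finset.mem_insert.mp hs with rfl | hs
  · apply inv; rw [← e, ← e']
  · apply inv; rw [hw.2 s hs, hw'.2 s hs]

/-- Induction hypothesis. -/
structure Good (D : GLData ι G) (S : Finset ι) (t : ι) (N : ℕ) : Prop where
  uniq : ∀ v c c', nrm v < N → D.R S t v c → D.R S t v c' → c = c'
  move : ∀ v c i j a, i ∉ S → i ≠ j → (a = 1 ∨ a = -1) → nrm v < N →
    nrm (D.ρ (D.E i j a) v) < N → D.R S t v c → D.R S t (D.ρ (D.E i j a) v) (D.E i j a • c)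

lemma ρ_comm {g h : G} (e : g * h = h * g) (v) : D.ρ g (D.ρ h v) = D.ρ h (D.ρ g v) := by
  rw [← Equiv.Perm.mul_apply, ← map_mul, e, map_mul, Equiv.Perm.mul_apply]

lemma diamond_comm {N v i j a k l b c c'} (hg : Good D S t N) (hN : nrm v = N)
    (h : Dn D S t v i j a c) (h' : Dn D S t v k l b c')
    (e : D.E k l b * D.E i j a = D.E i j a * D.E k l b)
    (hlt : nrm (D.ρ (D.E k l b) (D.ρ (D.E i j a) v)) < N) : c = c' := by
  have h1 := hg.move _ _ k l b h'.hi h'.hij h'.ha (hN ▸ h.hlt) hlt h.hR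
  have hlt' := hlt
  rw [ρ_comm e] at hlt'
  have h2 := hg.move _ _ i j a h.hi h.hij h.ha (hN ▸ h'.hlt) hlt' h'.hR
  rw [← ρ_comm e] at h2
  have h3 := hg.uniq _ _ _ hlt h1 h2
  rw [← mul_smul, ← mul_smul, e] at h3
  exact smul_left_cancel _ h3

lemma Dn.exists (ht : t ∉ S) {v} (hv : Prim S v) {i j a} (hi : i ∉ S) (hij : i ≠ j) (ha : a = 1 ∨ a = -1)
    (hlt : nrm (D.ρ (D.E i j a) v) < nrm v) : ∃ c, Dn D S t v i j a c := by
  obtain ⟨c, hc⟩ := R.exists (D := D) ht _ _ rfl (hv.E (D := D) hi hij a)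
  refine ⟨(D.E i j a)⁻¹ • c, hi, hij, ha, hlt, by rwa [smul_inv_smul]⟩

lemma Dn.lt {v i j a c} (h : Dn D S t v i j a c) : (v j + a * v i).natAbs < (v j).natAbs := by
  have := D.nrm_E h.hij a v
  have := h.hlt
  omega

lemma Dn.R {v i j a c} (h : Dn D S t v i j a c) : D.R S t v c := R.up h.hi h.hij h.ha h.hlt h.hR

/-- same source -/
lemma diamond_source {N v i j a l b c c'} (hg : Good D S t N) (hN : nrm v = N)
    (h : Dn D S t v i j a c) (h' : Dn D S t v i l b c') (hjl : j ≠ l) : c = c' := by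
  apply diamond_comm hg hN h h' (D.comm h'.hij h.hij h'.hij.symm h.hij _ _)
  have e1 := D.nrm_E h'.hij b (D.ρ (D.E i j a) v)
  rw [D.E_ne h.hij _ _ hjl.symm, D.E_ne h.hij _ _ h.hij] at e1
  have := h'.lt
  have := h.hlt
  omega

lemma diamond_disj {N v i j a k l b c c'} (hg : Good D S t N) (hN : nrm v = N)
    (h : Dn D S t v i j a c) (h' : Dn D S t v k l b c') (hjl : j ≠ l) (hjk : j ≠ k) (hil : i ≠ l) :
    c = c' := by
  apply diamond_comm hg hN h h' (D.comm h'.hij h.hij hil.symm hjk.symm _ _)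
  have e1 := D.nrm_E h'.hij b (D.ρ (D.E i j a) v)
  rw [D.E_ne h.hij _ _ hjl.symm, D.E_ne h.hij _ _ hjk.symm] at e1
  have := h'.lt
  have := h.hlt
  omega

lemma W_rot {i j} (hi : i ∉ S) (hj : j ∉ S) (h : i ≠ j) {a : ℤ} (ha : a = 1 ∨ a = -1) :
    D.WS S (D.E j i a * D.E i j (-a) * D.E j i a) := by
  constructor
  · rcases ha with rfl | rfl
    · exact D.rot h
    · have := D.W.inv_mem (D.rot h)
      simpa [D.E_inv h, D.E_inv h.symm, mul_assoc] using this
  · intro s hs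
    have hsi : i ≠ s := fun e => hi (e ▸ hs)
    have hst : j ≠ s := fun e => hj (e ▸ hs)
    simp only [map_mul, Equiv.Perm.mul_apply]
    rw [D.ρE h.symm, D.ρE h, D.ρE h.symm]
    ext k
    simp only [Function.update_apply, Pi.single_apply]
    split_ifs <;> simp_all

/-- rank two -/
lemma diamond_two {N v i j a b c c'} (hg : Good D S t N) (hN : nrm v = N)
    (h : Dn D S t v i j a c) (h' : Dn D S t v j i b c') : c = c' := by
  have l1 := h.lt
  have l2 := h'.lt
  have hab : b = a := by
    rcases h.ha with e | e <;> rcases h'.ha with e' | e' <;> subst e e' <;> first | rfl | (exfalso; omega)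
  subst hab
  -- `E j i (-b) * E i j b = w * E j i b`
  have hb : -b = 1 ∨ -b = -1 := by rcases h.ha with rfl | rfl <;> simp
  have hw := W_rot (D := D) h.hi h'.hi h.hij hb
  rw [neg_neg] at hw
  have h1 := h'.hR.w hw
  have e : D.E j i (-b) * D.E i j b * D.E j i (-b) * D.E j i b = D.E j i (-b) * D.E i j b := by
    rw [mul_assoc _ (D.E j i (-b)), D.E_neg_mul h'.hij, mul_one]
  rw [← mul_smul, ← Equiv.Perm.mul_apply, ← map_mul, e] at h1
  have h2 : nrm (D.ρ (D.E j i (-b) * D.E i j b) v) < N := by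
    rw [← e, map_mul, Equiv.Perm.mul_apply, nrm_w hw]
    exact hN ▸ h'.hlt
  have h3 := hg.move _ _ j i (-b) h'.hi h'.hij hb (hN ▸ h.hlt)
    (by rwa [← Equiv.Perm.mul_apply, ← map_mul]) h.hR
  rw [← mul_smul, ← Equiv.Perm.mul_apply, ← map_mul] at h3
  exact smul_left_cancel _ (hg.uniq _ _ _ h2 h3 h1)

lemma chain_rel {i j l} (hij : i ≠ j) (hjl : j ≠ l) (hil : i ≠ l) (a b : ℤ) :
    D.E i l (-(a * b)) * (D.E j l b * D.E i j a) = D.E i j a * D.E j l b := by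
  rw [D.chain hij hjl hil, D.comm hij hil hij.symm hil, ← D.E_inv hil]
  group

/-- chain -/
lemma diamond_chain (ht : t ∉ S) {N v i j a l b c c'} (hg : Good D S t N) (hN : nrm v = N)
    (h : Dn D S t v i j a c) (h' : Dn D S t v j l b c') (hil : i ≠ l) : c = c' := by
  have l1 := h.lt
  have l2 := h'.lt
  by_cases hle : (v i).natAbs ≤ (v j).natAbs
  · have hab : -(a * b) = 1 ∨ -(a * b) = -1 := by
      rcases h.ha with rfl | rfl <;> rcases h'.ha with rfl | rfl <;> simp
    have n1 := D.nrm_E h'.hij b (D.ρ (D.E i j a) v)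
    rw [D.E_ne h.hij _ _ h'.hij.symm, D.E_same h.hij] at n1
    have l3 := h.hlt
    have l4 := h'.hlt
    have n1' : nrm (D.ρ (D.E j l b) (D.ρ (D.E i j a) v)) < N := by
      rcases h.ha with e | e <;> rcases h'.ha with e' | e' <;> subst e e' <;> omega
    have n2 := D.nrm_E h.hij a (D.ρ (D.E j l b) v)
    rw [D.E_ne h'.hij _ _ h'.hij, D.E_ne h'.hij _ _ hil] at n2
    have n2' : nrm (D.ρ (D.E i j a) (D.ρ (D.E j l b) v)) < N := by omega
    have r1 := hg.move _ _ j l b h'.hi h'.hij h'.ha (hN ▸ h.hlt) n1' h.hR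
    have e : D.ρ (D.E i l (-(a * b))) (D.ρ (D.E j l b) (D.ρ (D.E i j a) v)) =
        D.ρ (D.E i j a) (D.ρ (D.E j l b) v) := by
      simp only [← Equiv.Perm.mul_apply, ← map_mul]
      rw [chain_rel h.hij h'.hij hil]
    have r2 := hg.move _ _ i l (-(a*b)) h.hi hil hab n1' (by rwa [e]) r1
    have r3 := hg.move _ _ i j a h.hi h.hij h.ha (hN ▸ h'.hlt) n2' h'.hR
    rw [e] at r2
    have := hg.uniq _ _ _ n2' r2 r3
    simp only [← mul_smul] at this
    rw [chain_rel h.hij h'.hij hil] at this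
    exact smul_left_cancel _ this
  · obtain ⟨c'', h''⟩ := Dn.exists (D := D) ht (h.R.prim ht) (i := j) (j := i) (a := a) h'.hi h.hij.symm h.ha (by
      have := D.nrm_E h.hij.symm a v
      rcases h.ha with e | e <;> subst e <;> omega)
    rw [diamond_two hg hN h h'', diamond_source hg hN h'' h' hil]

lemma diamond_target (ht : t ∉ S) {N v i j a k b c c'} (hg : Good D S t N) (hN : nrm v = N)
    (h : Dn D S t v i j a c) (h' : Dn D S t v k j b c') (hik : i ≠ k)
    (hle : (v i).natAbs ≤ (v k).natAbs) : c = c' := by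
  have l1 := h.lt
  have l2 := h'.lt
  have hd := D.nrm_E hik (-(a*b)) v
  obtain ⟨c'', h''⟩ := Dn.exists (D := D) ht (h.R.prim ht) (i := i) (j := k) (a := -(a*b)) h.hi hik
    (by rcases h.ha with rfl | rfl <;> rcases h'.ha with rfl | rfl <;> simp)
    (by rcases h.ha with e | e <;> rcases h'.ha with e' | e' <;> subst e e' <;> omega)
  rw [diamond_source hg hN h h'' h'.hij.symm, diamond_chain ht hg hN h'' h' h.hij]

lemma diamond (ht : t ∉ S) {N v i j a k l b c c'} (hg : Good D S t N) (hN : nrm v = N)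
    (h : Dn D S t v i j a c) (h' : Dn D S t v k l b c') : c = c' := by
  by_cases hjl : j = l
  · subst hjl
    by_cases hik : i = k
    · subst hik
      have l1 := h.lt
      have l2 := h'.lt
      have : a = b := by
        rcases h.ha with e | e <;> rcases h'.ha with e' | e' <;> subst e e' <;> first | rfl | (exfalso; omega)
      subst this
      exact smul_left_cancel _ (hg.uniq _ _ _ (hN ▸ h.hlt) h.hR h'.hR)
    · rcases le_total (v i).natAbs (v k).natAbs with hle | hle
      · exact diamond_target ht hg hN h h' hik hle
      · exact (diamond_target ht hg hN h' h (Ne.symm hik) hle).symm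
  · by_cases hjk : j = k
    · subst hjk
      by_cases hil : i = l
      · subst hil; exact diamond_two hg hN h h'
      · exact diamond_chain ht hg hN h h' hil
    · by_cases hil : i = l
      · subst hil
        exact (diamond_chain ht hg hN h' h (Ne.symm hjk)).symm
      · exact diamond_disj hg hN h h' hjl hjk hil

lemma uniq_step (ht : t ∉ S) {N} (hg : Good D S t N) {v c c'} (hN : nrm v ≤ N)
    (h : D.R S t v c) (h' : D.R S t v c') : c = c' := by
  rcases lt_or_eq_of_le hN with hN | hN
  · exact hg.uniq _ _ _ hN h h'
  · by_cases h1 : nrm v = 1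
    · exact R.base_uniq ht h1 h h'
    · obtain ⟨i, j, a, hd⟩ := h.cases_dn ht h1
      obtain ⟨k, l, b, hd'⟩ := h'.cases_dn ht h1
      exact diamond ht hg hN hd hd'

lemma desc_step (ht : t ∉ S) {N} (hg : Good D S t N) {v c i j a} (hi : i ∉ S) (hij : i ≠ j)
    (ha : a = 1 ∨ a = -1) (hN : nrm v ≤ N) (hlt : nrm (D.ρ (D.E i j a) v) < nrm v)
    (h : D.R S t v c) : D.R S t (D.ρ (D.E i j a) v) (D.E i j a • c) := by
  obtain ⟨c', hc'⟩ := Dn.exists ht (h.prim ht) hi hij ha hlt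
  rw [uniq_step ht hg hN h hc'.R]
  exact hc'.hR

lemma level_step (ht : t ∉ S) {N} (hg : Good D S t N) {v c i j a} (hi : i ∉ S) (hij : i ≠ j)
    (ha : a = 1 ∨ a = -1) (hN : nrm v = N) (heq : nrm (D.ρ (D.E i j a) v) = nrm v) (h0 : v i ≠ 0)
    (h : D.R S t v c) : D.R S t (D.ρ (D.E i j a) v) (D.E i j a • c) := by
  have hvij : v i = - 2 * a * v j := by
    have := D.nrm_E hij a v
    rcases ha with e | e <;> subst e <;> omega
  have ha' : -a = 1 ∨ -a = -1 := by rcases ha with rfl | rfl <;> simp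
  by_cases hj : j ∉ S
  · have n1 := D.nrm_E hij.symm a v
    have n1' : nrm (D.ρ (D.E j i a) v) < nrm v := by
      rcases ha with e | e <;> subst e <;> omega
    have r1 := desc_step ht hg hj hij.symm ha hN.le n1' h
    have hw := W_rot (D := D) hi hj hij ha'
    rw [neg_neg] at hw
    have h1 := r1.w hw
    have e : D.E j i (-a) * D.E i j a * D.E j i (-a) * D.E j i a = D.E j i (-a) * D.E i j a := by
      rw [mul_assoc _ (D.E j i (-a)), D.E_neg_mul hij.symm, mul_one]
    have n2 : nrm (D.ρ (D.E j i (-a) * D.E i j a) v) < N := by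
      rw [← e, map_mul, Equiv.Perm.mul_apply, nrm_w hw]
      exact hN ▸ n1'
    rw [← mul_smul, ← Equiv.Perm.mul_apply, ← map_mul, e] at h1
    refine R.up hj hij.symm ha' ?_ ?_
    · rw [heq, ← Equiv.Perm.mul_apply, ← map_mul, hN]; exact n2
    · rwa [← mul_smul, ← Equiv.Perm.mul_apply, ← map_mul]
  · push Not at hj
    have : ∃ k, k ∉ S ∧ k ≠ i ∧ v k ≠ 0 := by
      by_contra hc
      push Not at hc
      have : IsUnit (v i) := by
        apply h.prim ht
        intro k hk
        by_cases hki : k = i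
        · subst hki; simp
        · rw [hc k hk hki]; simp
      rw [Int.isUnit_iff] at this
      rcases ha with e | e <;> subst e <;> omega
    obtain ⟨k, hk, hki, hvk⟩ := this
    have hkj : k ≠ j := fun e => hk (e ▸ hj)
    by_cases hle : (v i).natAbs ≤ (v k).natAbs
    · have : ∃ b : ℤ, (b = 1 ∨ b = -1) ∧ (v k + b * v i).natAbs < (v k).natAbs := by
        by_cases hs : (v k + 1 * v i).natAbs < (v k).natAbs
        · exact ⟨1, Or.inl rfl, hs⟩
        · exact ⟨-1, Or.inr rfl, by omega⟩
      obtain ⟨b, hb, hblt⟩ := this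
      have n1 := D.nrm_E hki.symm b v
      have n1' : nrm (D.ρ (D.E i k b) v) < nrm v := by omega
      have r1 := desc_step ht hg hi hki.symm hb hN.le n1' h
      have e := D.comm hij hki.symm hij.symm hki.symm a b
      have n2 := D.nrm_E hij a (D.ρ (D.E i k b) v)
      rw [D.E_ne hki.symm _ _ hkj.symm, D.E_ne hki.symm _ _ hki.symm] at n2
      have n3 := D.nrm_E hij a v
      have r2 := hg.move _ _ i j a hi hij ha (hN ▸ n1') (by omega) r1
      rw [ρ_comm e, ← mul_smul, e, mul_smul] at r2
      refine R.up hi hki.symm hb ?_ r2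
      rw [← ρ_comm e]
      omega
    · have : ∃ b : ℤ, (b = 1 ∨ b = -1) ∧ (v i + b * v k).natAbs < (v i).natAbs := by
        by_cases hs : (v i + 1 * v k).natAbs < (v i).natAbs
        · exact ⟨1, Or.inl rfl, hs⟩
        · exact ⟨-1, Or.inr rfl, by omega⟩
      obtain ⟨b, hb, hblt⟩ := this
      have n1 := D.nrm_E hki b v
      have n1' : nrm (D.ρ (D.E k i b) v) < nrm v := by omega
      have r1 := desc_step ht hg hk hki hb hN.le n1' h
      have n2 := D.nrm_E hij a (D.ρ (D.E k i b) v)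
      rw [D.E_ne hki _ _ hij.symm, D.E_same hki] at n2
      have n2' : nrm (D.ρ (D.E i j a) (D.ρ (D.E k i b) v)) < N := by
        rcases ha with e | e <;> rcases hb with e' | e' <;> subst e e' <;> omega
      have r2 := hg.move _ _ i j a hi hij ha (hN ▸ n1') n2' r1
      have hab : -(b * a) = 1 ∨ -(b * a) = -1 := by
        rcases ha with rfl | rfl <;> rcases hb with rfl | rfl <;> simp
      have e : D.ρ (D.E k j (-(b * a))) (D.ρ (D.E i j a) (D.ρ (D.E k i b) v)) =
          D.ρ (D.E k i b) (D.ρ (D.E i j a) v) := by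
        simp only [← Equiv.Perm.mul_apply, ← map_mul]
        rw [chain_rel hki hij hkj]
      have n3 := D.nrm_E hki b (D.ρ (D.E i j a) v)
      rw [D.E_ne hij _ _ hij, D.E_ne hij _ _ hkj] at n3
      have r3 := hg.move _ _ k j (-(b*a)) hk hkj hab n2' (by rw [e]; omega) r2
      rw [e] at r3
      simp only [← mul_smul] at r3
      rw [chain_rel hki hij hkj, mul_smul] at r3
      exact R.up hk hki hb (by omega) r3

lemma good (ht : t ∉ S) (N : ℕ) : Good D S t N := by
  induction N with
  | zero => exact ⟨fun _ _ _ h => absurd h (Nat.not_lt_zero _), fun _ _ _ _ _ _ _ _ h => absurd h (Nat.not_lt_zero _)⟩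
  | succ N hg =>
    refine ⟨fun v c c' hN h h' => uniq_step ht hg (by omega) h h', ?_⟩
    intro v c i j a hi hij ha hN hN' h
    by_cases h0 : v i = 0
    · rw [h.zero ht hi hij a h0, D.ρE hij, h0]
      simpa using h
    rcases lt_trichotomy (nrm (D.ρ (D.E i j a) v)) (nrm v) with hlt | heq | hlt
    · exact desc_step ht hg hi hij ha (by omega) hlt h
    · by_cases hN2 : nrm v < N
      · exact hg.move _ _ _ _ _ hi hij ha hN2 (by omega) h
      · exact level_step ht hg hi hij ha (by omega) heq h0 h
    · exact R.step _ _ _ _ _ hi hij ha hlt h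

lemma R.E_one (ht : t ∉ S) {v c i j a} (hi : i ∉ S) (hij : i ≠ j) (ha : a = 1 ∨ a = -1) (h : D.R S t v c) :
    D.R S t (D.ρ (D.E i j a) v) (D.E i j a • c) :=
  (good ht (nrm v + nrm (D.ρ (D.E i j a) v) + 1)).move _ _ _ _ _ hi hij ha (by omega) (by omega) h

lemma R.E (ht : t ∉ S) {v c i j} (hi : i ∉ S) (hij : i ≠ j) (a : ℤ) (h : D.R S t v c) :
    D.R S t (D.ρ (D.E i j a) v) (D.E i j a • c) := by
  induction a using Int.induction_on with
  | zero => simpa [D.E_zero hij] using h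
  | succ n ih =>
    have := ih.E_one ht hi hij (a := 1) (Or.inl rfl)
    rwa [← mul_smul, ← Equiv.Perm.mul_apply, ← map_mul, ← D.E_add hij, add_comm 1 (n:ℤ)] at this
  | pred n ih =>
    have := ih.E_one ht hi hij (a := -1) (Or.inr rfl)
    rwa [← mul_smul, ← Equiv.Perm.mul_apply, ← map_mul, ← D.E_add hij, add_comm (-1) (-(n:ℤ))] at this

lemma R.H (ht : t ∉ S) {g} (hg : g ∈ D.H S) : ∀ {v c}, D.R S t v c → D.R S t (D.ρ g v) (g • c) := by
  induction hg using Subgroup.closure_induction'' with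
  | mem x hx =>
    intro v c h
    rcases hx with ⟨i, j, a, hi, hij, rfl⟩ | hw
    · exact h.E ht hi hij a
    · exact h.w hw
  | inv_mem x hx =>
    intro v c h
    rcases hx with ⟨i, j, a, hi, hij, rfl⟩ | hw
    · rw [D.E_inv hij]; exact h.E ht hi hij _
    · refine h.w ⟨D.W.inv_mem hw.1, fun s hs => ?_⟩
      rw [map_inv, Equiv.Perm.inv_eq_iff_eq, hw.2 s hs]
  | one => intro v c h; simpa using h
  | mul x y hx hy ihx ihy =>
    intro v c h
    rw [map_mul, mul_smul]
    exact ihx (ihy h)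

lemma stab (ht : t ∉ S) {g} (hg : g ∈ D.H S) (h : D.ρ g (Pi.single t 1) = Pi.single t 1) :
    g ∈ D.H (insert t S) := by
  have r0 := R.base (D := D) (S := S) (t := t) 1 ⟨D.W.one_mem, by simp⟩
  have r1 := r0.H ht hg
  simp only [map_one, Equiv.Perm.one_apply, one_smul] at r0 r1
  rw [h] at r1
  have := (good ht _).uniq _ _ _ (Nat.lt_succ_self _) r0 r1
  rw [smul_coe, mul_one] at this
  simpa using QuotientGroup.eq.mp this

variable (D) in
theorem injective (hgen : D.H ∅ = ⊤) : Function.Injective D.ρ := by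
  rw [injective_iff_map_eq_one]
  intro g hg
  have key : ∀ S : Finset ι, g ∈ D.H S := by
    intro S
    induction S using Finset.induction_on with
    | empty => rw [hgen]; trivial
    | insert t S ht ih => exact stab ht ih (by rw [hg]; rfl)
  have h := key Finset.univ
  unfold GLData.H at h
  have : Subgroup.closure ({g | ∃ i j a, i ∉ Finset.univ ∧ i ≠ j ∧ g = D.E i j a} ∪
    {w | w ∈ D.W ∧ ∀ s ∈ Finset.univ, D.ρ w (Pi.single s 1) = Pi.single s 1}) ≤ ⊥ := by
    rw [Subgroup.closure_le]
    rintro x (⟨i, j, a, hi, _⟩ | ⟨hw, hs⟩)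
    · simp at hi
    · have hws : D.WS Finset.univ x := ⟨hw, hs⟩
      obtain ⟨σ, ε, h1, h2, h3, h4, h5⟩ := D.WS_spec hws
      simp only [SetLike.mem_coe, Subgroup.mem_bot]
      apply D.injW x hw
      ext v i
      have := h2 v i
      rw [(h4 i (Finset.mem_univ i)).1, (h4 i (Finset.mem_univ i)).2] at this
      simp [this]
  exact Subgroup.mem_bot.mp (this h)

end GLData


set_option linter.unusedSectionVars false
set_option linter.unusedVariables false

namespace NielsenRed

open FreeGroup hiding norm IsReduced map_inv map_mul map_one map

variable {ι : Type} [DecidableEq ι]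

/-- longest common initial segment length -/
def lcp {α : Type} [DecidableEq α] : List α → List α → ℕ
  | a :: l, b :: m => if a = b then lcp l m + 1 else 0
  | _, _ => 0

section
variable {α : Type} [DecidableEq α]

lemma lcp_spec : ∀ (l m : List α), ∃ p s r, l = p ++ s ∧ m = p ++ r ∧ p.length = lcp l m ∧
    ∀ a ∈ s.head?, ∀ b ∈ r.head?, a ≠ b
  | [], m => ⟨[], [], m, by simp [lcp]⟩
  | a :: l, [] => ⟨[], a :: l, [], by simp [lcp]⟩
  | a :: l, b :: m => by
    by_cases h : a = b
    · obtain ⟨p, s, r, h1, h2, h3, h4⟩ := lcp_spec l m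
      refine ⟨a :: p, s, r, by simp [h1], by simp [h2, h], by simp [lcp, h, h3], h4⟩
    · exact ⟨[], a :: l, b :: m, by simp [lcp, h]⟩

lemma lcp_comm : ∀ (l m : List α), lcp l m = lcp m l
  | [], [] => rfl
  | [], _ :: _ => by simp [lcp]
  | _ :: _, [] => by simp [lcp]
  | a :: l, b :: m => by
    by_cases h : a = b
    · subst h; simp [lcp, lcp_comm l m]
    · simp [lcp, h, Ne.symm h]

lemma lcp_iso : ∀ (l m k : List α), lcp l m < lcp l k → lcp k m = lcp l m
  | [], m, k => by simp [lcp]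
  | a :: l, m, [] => by simp [lcp]
  | a :: l, [], b :: k => by simp [lcp]
  | a :: l, c :: m, b :: k => by
    intro h
    by_cases hab : a = b
    · subst hab
      by_cases hac : a = c
      · subst hac
        simp [lcp] at h ⊢
        exact lcp_iso l m k h
      · simp [lcp, hac]
    · simp [lcp, hab] at h

lemma lcp_take : ∀ (l m : List α) (k : ℕ), k ≤ lcp l m → l.take k = m.take k
  | [], m, k => by cases m <;> simp [lcp]
  | a :: l, [], k => by simp [lcp]
  | a :: l, b :: m, 0 => by simp
  | a :: l, b :: m, k+1 => by
    intro h
    by_cases hab : a = b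
    · subst hab
      simp [lcp] at h ⊢
      exact lcp_take l m k h
    · simp [lcp, hab] at h
end

lemma isReduced_invRev {L : List (ι × Bool)} (h : FreeGroup.IsReduced L) : FreeGroup.IsReduced (invRev L) := by
  rw [isReduced_iff_reduce_eq] at *
  rw [reduce_invRev, h]

lemma isReduced_glue {s r : List (ι × Bool)} (hs : FreeGroup.IsReduced s) (hr : FreeGroup.IsReduced r)
    (h : ∀ a ∈ s.head?, ∀ b ∈ r.head?, a ≠ b) : FreeGroup.IsReduced (invRev s ++ r) := by
  unfold FreeGroup.IsReduced
  rw [List.isChain_append]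
  refine ⟨isReduced_invRev hs, hr, ?_⟩
  intro x hx y hy hxy
  cases s with
  | nil => simp at hx
  | cons a s =>
    have hx' : x = (a.1, !a.2) := by simpa [invRev, eq_comm] using hx
    subst hx'
    have := h a (by simp) y hy
    simp at hxy
    by_contra hc
    apply this
    ext
    · exact hxy
    · revert hc; cases a.2 <;> cases y.2 <;> simp

abbrev c (g h : FreeGroup ι) : ℕ := lcp g.toWord h.toWord

lemma c_spec (g h : FreeGroup ι) : ∃ p s r, g.toWord = p ++ s ∧ h.toWord = p ++ r ∧ p.length = c g h ∧
    (g⁻¹ * h).toWord = invRev s ++ r := by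
  obtain ⟨p, s, r, h1, h2, h3, h4⟩ := lcp_spec g.toWord h.toWord
  refine ⟨p, s, r, h1, h2, h3, ?_⟩
  have hs : FreeGroup.IsReduced s := List.IsChain.right_of_append (l₁ := p) (h1 ▸ isReduced_toWord (x := g))
  have hr : FreeGroup.IsReduced r := List.IsChain.right_of_append (l₁ := p) (h2 ▸ isReduced_toWord (x := h))
  rw [← (isReduced_glue hs hr h4).reduce_eq, ← toWord_mk]
  congr 1
  conv_lhs => rw [← mk_toWord (x := g), ← mk_toWord (x := h), h1, h2]
  rw [← mul_mk, ← mul_mk, ← mul_mk, ← inv_mk]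
  group

lemma norm_c (g h : FreeGroup ι) : (g⁻¹ * h).norm + 2 * c g h = g.norm + h.norm := by
  obtain ⟨p, s, r, h1, h2, h3, h4⟩ := c_spec g h
  simp only [FreeGroup.norm, h1, h2, h4, ← h3, List.length_append, invRev_length]
  omega

lemma norm_mul_c (g h : FreeGroup ι) : (g * h).norm + 2 * c g⁻¹ h = g.norm + h.norm := by
  have := norm_c g⁻¹ h
  rwa [inv_inv, norm_inv_eq] at this

lemma c_comm (g h : FreeGroup ι) : c g h = c h g := lcp_comm _ _

/-- squares cancel less than half -/
lemma c_self (g : FreeGroup ι) (hg : g ≠ 1) : 2 * c g⁻¹ g < g.norm := by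
  by_contra hc
  push Not at hc
  have h1 := lcp_take _ _ (c g⁻¹ g) le_rfl
  rw [toWord_inv] at h1
  set w := g.toWord with hw
  have hred : FreeGroup.IsReduced w := isReduced_toWord
  have hpos : 0 < w.length := by
    rw [List.length_pos_iff]; intro h; exact hg (toWord_eq_nil_iff.mp h)
  have hn : g.norm = w.length := rfl
  rw [hn] at hc
  set k := c g⁻¹ g
  -- index `i = (n-1)/2`
  have key : ∀ i (hi : i < w.length), i < k → w[i] = ((w[w.length - 1 - i]).1, !(w[w.length - 1 - i]).2) := by
    intro i hi hik
    have h2 : (List.take k (invRev w))[i]? = (List.take k w)[i]? := by rw [h1]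
    rw [List.getElem?_take_of_lt hik, List.getElem?_take_of_lt hik] at h2
    rw [List.getElem?_eq_getElem hi, List.getElem?_eq_getElem (by simpa using hi)] at h2
    have h3 := (Option.some.inj h2).symm
    rw [h3]
    simp [invRev]
  rcases Nat.even_or_odd' w.length with ⟨m, hm | hm⟩
  · have := key (m-1) (by omega) (by omega)
    have e : w.length - 1 - (m-1) = (m-1)+1 := by omega
    simp only [e] at this
    unfold FreeGroup.IsReduced at hred
    rw [List.isChain_iff_getElem] at hred
    have h5 := hred (m-1) (by omega)
    rw [this] at h5
    simp at h5
  · have := key m (by omega) (by omega)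
    have e : w.length - 1 - m = m := by omega
    simp only [e] at this
    have := congrArg Prod.snd this
    simp at this

/-- code of a word -/
noncomputable def code [Fintype ι] (l : List (ι × Bool)) : ℕ :=
  Nat.ofDigits (Fintype.card (ι × Bool) + 2) (l.map fun x => (Fintype.equivFin (ι × Bool) x : ℕ))

lemma code_append [Fintype ι] (p r : List (ι × Bool)) :
    code (p ++ r) = code p + (Fintype.card (ι × Bool) + 2) ^ p.length * code r := by
  unfold code
  rw [List.map_append, Nat.ofDigits_append, List.length_map]

lemma code_inj [Fintype ι] {p q : List (ι × Bool)} (hl : p.length = q.length) (h : code p = code q) : p = q := by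
  unfold code at h
  have := Nat.ofDigits_inj_of_len_eq (by omega) (by simpa using hl) ?_ ?_ h
  · refine List.map_injective_iff.mpr ?_ this
    intro x y hxy
    exact (Fintype.equivFin (ι × Bool)).injective (Fin.ext hxy)
  · intro l hl
    obtain ⟨x, _, rfl⟩ := List.mem_map.mp hl
    have := (Fintype.equivFin (ι × Bool) x).isLt
    omega
  · intro l hl
    obtain ⟨x, _, rfl⟩ := List.mem_map.mp hl
    have := (Fintype.equivFin (ι × Bool) x).isLt
    omega

/-- initial half -/
def half (g : FreeGroup ι) : List (ι × Bool) := g.toWord.take ((g.norm + 1) / 2)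

variable [Fintype ι]

abbrev inl (l : ι × Bool) : ι × Bool := (l.1, !l.2)

lemma mk_inl (l : ι × Bool) : (mk [inl l] : FreeGroup ι) = (mk [l])⁻¹ := by
  simp [inv_mk, invRev]

def U (ψ : MulAut (FreeGroup ι)) (l : ι × Bool) : FreeGroup ι := ψ (mk [l])

lemma U_inl (ψ : MulAut (FreeGroup ι)) (l : ι × Bool) : U ψ (inl l) = (U ψ l)⁻¹ := by
  unfold U; rw [mk_inl, map_inv]

lemma U_ne_one (ψ : MulAut (FreeGroup ι)) (l : ι × Bool) : U ψ l ≠ 1 := by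
  unfold U
  intro h
  rw [map_eq_one_iff _ ψ.injective] at h
  have := congrArg toWord h
  simp at this

def len (ψ : MulAut (FreeGroup ι)) : ℕ := ∑ l, (U ψ l).norm
noncomputable def pot (ψ : MulAut (FreeGroup ι)) : ℕ := ∑ l, code (half (U ψ l))

/-- `ν` is the elementary move `l ↦ l m` -/
structure IsMove (ν : MulAut (FreeGroup ι)) (l m : ι × Bool) : Prop where
  h1 : ν (mk [l]) = mk [l] * mk [m]
  h2 : ∀ k : ι × Bool, k.1 ≠ l.1 → ν (mk [k]) = mk [k]

lemma sum_move {ψ ν : MulAut (FreeGroup ι)} {l m} (h : IsMove ν l m) (f : FreeGroup ι → ℕ) :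
    ∑ k, f (U (ψ * ν) k) + (f (U ψ l) + f (U ψ l)⁻¹) =
      ∑ k, f (U ψ k) + (f (U ψ l * U ψ m) + f (U ψ l * U ψ m)⁻¹) := by
  have hne : l ≠ inl l := by intro h; simpa using congrArg Prod.snd h
  have e : ∀ g : ι × Bool → ℕ, ∑ k, g k = g l + g (inl l) + ∑ k ∈ Finset.univ.filter (fun k => k.1 ≠ l.1), g k := by
    intro g
    rw [← Finset.sum_filter_add_sum_filter_not Finset.univ (fun k : ι × Bool => k.1 = l.1)]
    congr 1
    rw [← Finset.sum_pair hne]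
    apply Finset.sum_congr _ (fun _ _ => rfl)
    ext ⟨i, b⟩
    rcases l with ⟨j, b'⟩
    cases b <;> cases b' <;> simp
  rw [e (fun k => f (U (ψ * ν) k)), e (fun k => f (U ψ k))]
  have e1 : U (ψ * ν) l = U ψ l * U ψ m := by
    show ψ (ν (mk [l])) = _
    rw [h.h1, map_mul]; rfl
  have e2 : ∑ k ∈ Finset.univ.filter (fun k : ι × Bool => k.1 ≠ l.1), f (U (ψ * ν) k) =
      ∑ k ∈ Finset.univ.filter (fun k : ι × Bool => k.1 ≠ l.1), f (U ψ k) := by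
    apply Finset.sum_congr rfl
    intro k hk
    have := h.h2 k (by simpa using hk)
    simp [U, MulAut.mul_apply, this]
  rw [e2]
  simp only [U_inl, e1]
  omega

variable {K : Subgroup (MulAut (FreeGroup ι))}

/-- minimality in a coset -/
structure Minim (K : Subgroup (MulAut (FreeGroup ι))) (ψ : MulAut (FreeGroup ι)) : Prop where
  h1 : ∀ ν ∈ K, len ψ ≤ len (ψ * ν)
  h2 : ∀ ν ∈ K, len (ψ * ν) = len ψ → pot ψ ≤ pot (ψ * ν)

lemma exists_minim (φ : MulAut (FreeGroup ι)) : ∃ ν ∈ K, Minim K (φ * ν) := by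
  obtain ⟨ν₀, h₀⟩ := exists_minimalFor_of_wellFoundedLT (fun ν => ν ∈ K)
    (fun ν => toLex (len (φ * ν), pot (φ * ν))) ⟨1, K.one_mem⟩
  have key : ∀ ν ∈ K, toLex (len (φ * ν₀), pot (φ * ν₀)) ≤ toLex (len (φ * ν₀ * ν), pot (φ * ν₀ * ν)) := by
    intro ν hν
    have h1 : ν₀ * ν ∈ K := K.mul_mem h₀.1 hν
    rw [mul_assoc]
    rcases le_total (toLex (len (φ * ν₀), pot (φ * ν₀))) (toLex (len (φ * (ν₀ * ν)), pot (φ * (ν₀ * ν)))) with h | h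
    · exact h
    · exact h₀.2 h1 h
  refine ⟨ν₀, h₀.1, fun ν hν => ?_, fun ν hν he => ?_⟩
  · have := key ν hν
    rw [Prod.Lex.toLex_le_toLex] at this
    rcases this with h | h
    · exact h.le
    · exact h.1.le
  · have := key ν hν
    rw [Prod.Lex.toLex_le_toLex] at this
    rcases this with h | h
    · simp at h; omega
    · exact h.2

section main
variable {ψ : MulAut (FreeGroup ι)}

lemma N1 (hT : ∀ l m : ι × Bool, l.1 ≠ m.1 → ∃ ν ∈ K, IsMove ν l m) (hψ : Minim K ψ)
    {l m : ι × Bool} (h : l.1 ≠ m.1) : (U ψ l).norm ≤ (U ψ l * U ψ m).norm := by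
  obtain ⟨ν, hν, hm⟩ := hT l m h
  have h1 := sum_move (ψ := ψ) hm FreeGroup.norm
  have h2 := hψ.h1 ν hν
  simp only [norm_inv_eq] at h1
  unfold len at h2
  omega

/-- cancellation at most half of each -/
lemma N1' (hT : ∀ l m : ι × Bool, l.1 ≠ m.1 → ∃ ν ∈ K, IsMove ν l m) (hψ : Minim K ψ)
    {l m : ι × Bool} (h : m ≠ inl l) : 2 * c (U ψ l)⁻¹ (U ψ m) ≤ (U ψ m).norm := by
  by_cases h1 : l.1 = m.1
  · have : m = l := by
      rcases l with ⟨i, b⟩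
      rcases m with ⟨j, b'⟩
      simp at h1
      subst h1
      cases b <;> cases b' <;> simp_all
    subst this
    exact (c_self _ (U_ne_one _ _)).le
  · have := N1 hT hψ h1
    have := norm_mul_c (U ψ l) (U ψ m)
    omega

lemma N1'' (hT : ∀ l m : ι × Bool, l.1 ≠ m.1 → ∃ ν ∈ K, IsMove ν l m) (hψ : Minim K ψ)
    {l m : ι × Bool} (h : m ≠ inl l) : 2 * c (U ψ l)⁻¹ (U ψ m) ≤ (U ψ l).norm := by
  have := N1' hT hψ (l := inl m) (m := inl l) (by
    intro e; apply h
    rcases l with ⟨i, b⟩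
    rcases m with ⟨j, b'⟩
    simp at e ⊢
    exact ⟨e.1.symm, by have := e.2; revert this; cases b <;> cases b' <;> simp⟩)
  rw [U_inl, U_inl, inv_inv, norm_inv_eq, c_comm] at this
  exact this

lemma tie (hT : ∀ l m : ι × Bool, l.1 ≠ m.1 → ∃ ν ∈ K, IsMove ν l m) (hψ : Minim K ψ)
    {b d : ι × Bool} (hbd : b.1 ≠ d.1) (hc : 2 * c (U ψ b)⁻¹ (U ψ d) = (U ψ b).norm) :
    code ((U ψ d).toWord.take (c (U ψ b)⁻¹ (U ψ d))) ≤
      code ((U ψ b).toWord.take (c (U ψ b)⁻¹ (U ψ d))) := by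
  obtain ⟨ν, hν, hm⟩ := hT (inl d) (inl b) (Ne.symm hbd)
  have hle := N1' hT hψ (l := b) (m := d) (by rintro rfl; simp at hbd)
  obtain ⟨q, s, r, h1, h2, h3, h4⟩ := c_spec (U ψ b)⁻¹ (U ψ d)
  set h := c (U ψ b)⁻¹ (U ψ d) with hh
  rw [inv_inv] at h4
  have hn1 : (U ψ b).norm = q.length + s.length := by
    rw [← norm_inv_eq, FreeGroup.norm, h1, List.length_append]
  have hn2 : (U ψ d).norm = q.length + r.length := by
    rw [FreeGroup.norm, h2, List.length_append]
  have hb : (U ψ b).toWord = invRev s ++ invRev q := by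
    rw [← invRev_append, ← h1, toWord_inv, invRev_invRev]
  have hn3 : (U ψ b * U ψ d).norm = s.length + r.length := by
    rw [FreeGroup.norm, h4]; simp
  have sl : s.length = h := by omega
  have e1 : (U ψ d).toWord.take h = q := by rw [h2, ← h3]; simp
  have e2 : (U ψ b).toWord.take h = invRev s := by
    rw [hb, ← sl]; rw [← invRev_length (L₁ := s)]; simp
  rw [e1, e2]
  have hlen := sum_move (ψ := ψ) hm FreeGroup.norm
  have hpot := sum_move (ψ := ψ) hm (fun g => code (half g))
  have hl : len (ψ * ν) = len ψ := by
    unfold len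
    simp only [U_inl, norm_inv_eq, inv_inv, ← mul_inv_rev] at hlen
    omega
  have hp := hψ.h2 ν hν hl
  unfold pot at hp
  simp only [U_inl, inv_inv, ← mul_inv_rev] at hpot
  -- halves
  have k1 : half (U ψ d) = q ++ r.take (((U ψ d).norm + 1) / 2 - h) := by
    unfold half
    rw [h2, List.take_append, List.take_of_length_le (by omega), h3]
  have k2 : half (U ψ b * U ψ d) = invRev s ++ r.take (((U ψ d).norm + 1) / 2 - h) := by
    unfold half
    rw [h4, List.take_append, List.take_of_length_le (by simp; omega), hn3, invRev_length, sl, hn2, h3]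
  have k3 : half (U ψ b * U ψ d)⁻¹ = half (U ψ d)⁻¹ := by
    unfold half
    rw [toWord_inv, toWord_inv, h4, h2, norm_inv_eq, norm_inv_eq, hn3, hn2, invRev_append, invRev_append,
      List.take_append_of_le_length (by simp; omega), List.take_append_of_le_length (by simp; omega), sl, h3]
  rw [k3, k1, k2, code_append, code_append, invRev_length, sl, h3] at hpot
  omega

lemma N2 (hT : ∀ l m : ι × Bool, l.1 ≠ m.1 → ∃ ν ∈ K, IsMove ν l m) (hψ : Minim K ψ)
    {a b d : ι × Bool} (hab : b ≠ inl a) (hbd : d ≠ inl b) :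
    c (U ψ a)⁻¹ (U ψ b) + c (U ψ b)⁻¹ (U ψ d) < (U ψ b).norm := by
  have h1 := N1' hT hψ hab
  have h2 := N1'' hT hψ hbd
  by_contra hc
  have h3 : 2 * c (U ψ a)⁻¹ (U ψ b) = (U ψ b).norm := by omega
  have h4 : 2 * c (U ψ b)⁻¹ (U ψ d) = (U ψ b).norm := by omega
  have ne1 : a ≠ b := by
    rintro rfl
    have := c_self _ (U_ne_one ψ a)
    omega
  have ne2 : d ≠ b := by
    rintro rfl
    have := c_self _ (U_ne_one ψ d)
    omega
  have aux : ∀ {x y : ι × Bool}, x ≠ y → x ≠ inl y → x.1 ≠ y.1 := by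
    rintro ⟨x, b⟩ ⟨y, b'⟩ hx hy e
    simp at e
    subst e
    cases b <;> cases b' <;> simp_all
  have f1 : b.1 ≠ d.1 := Ne.symm (aux ne2 hbd)
  have f2 : b.1 ≠ a.1 := aux ne1.symm hab
  have t1 := tie hT hψ f1 h4
  have t2 := tie hT hψ (b := inl b) (d := inl a) f2 (by
    rw [U_inl, U_inl, inv_inv, norm_inv_eq, c_comm]; exact h3)
  rw [U_inl, U_inl, inv_inv, c_comm (U ψ b)] at t2
  have hk : c (U ψ a)⁻¹ (U ψ b) = c (U ψ b)⁻¹ (U ψ d) := by omega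
  rw [hk] at t2
  rw [lcp_take _ _ _ hk.ge] at t2
  rw [← lcp_take _ _ _ (le_refl (c (U ψ b)⁻¹ (U ψ d)))] at t1
  have e := le_antisymm t1 t2
  have hl : ∀ g : FreeGroup ι, g.toWord.length = g.norm := fun _ => rfl
  have e2 := code_inj (by simp only [List.length_take, hl, norm_inv_eq]) e
  have hlt := c_self _ (U_ne_one ψ b)
  -- but common initial segment then has length at least half
  have : ∀ (l m : List (ι × Bool)) k, k ≤ l.length → l.take k = m.take k → k ≤ lcp l m := by
    intro l
    induction l with
    | nil => intro m k hk; simp at hk; omega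
    | cons x l ih =>
      intro m k hk e
      cases k with
      | zero => omega
      | succ k =>
        cases m with
        | nil => simp at e
        | cons y m =>
          simp at e hk
          have := ih m k hk e.2
          simp [lcp, e.1, this]
  have := this _ _ _ (by rw [hl, norm_inv_eq]; omega) e2
  change _ ≤ c _ _ at this
  omega

lemma main_len (hT : ∀ l m : ι × Bool, l.1 ≠ m.1 → ∃ ν ∈ K, IsMove ν l m) (hψ : Minim K ψ)
    : ∀ (L : List (ι × Bool)) (d : ι × Bool), FreeGroup.IsReduced (d :: L) → ∀ b, d ≠ inl b →
    c (U ψ b)⁻¹ (ψ (mk (d :: L))) = c (U ψ b)⁻¹ (U ψ d) ∧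
    c (U ψ b)⁻¹ (U ψ d) + (d :: L).length ≤ (ψ (mk (d :: L))).norm := by
  intro L
  induction L with
  | nil =>
    intro d _ b hb
    refine ⟨rfl, ?_⟩
    have := N1' hT hψ hb
    have h0 : (U ψ d).norm ≠ 0 := fun h => U_ne_one ψ d (norm_eq_zero.mp h)
    change _ ≤ (U ψ d).norm
    simp only [List.length_singleton]
    omega
  | cons d' L ih =>
    intro d hred b hb
    have hd : d' ≠ inl d := by
      rintro rfl
      rw [isReduced_cons_cons] at hred
      have := hred.1 rfl
      simp at this
    have hred' : FreeGroup.IsReduced (d' :: L) := List.IsChain.right_of_append (l₁ := [d]) hred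
    obtain ⟨i1, i2⟩ := ih d' hred' d hd
    have n2 := N2 hT hψ hb hd
    set Q' := ψ (mk (d' :: L)) with hQ'
    have hQ : ψ (mk (d :: d' :: L)) = U ψ d * Q' := by
      rw [hQ', U, ← map_mul, mul_mk]; rfl
    rw [hQ]
    have e1 := norm_mul_c (U ψ d) Q'
    rw [i1] at e1
    have e2 := norm_c (U ψ d) (U ψ d * Q')
    rw [inv_mul_cancel_left] at e2
    constructor
    · have := lcp_iso (U ψ d).toWord (U ψ b)⁻¹.toWord (U ψ d * Q').toWord (by
        change c _ _ < c _ _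
        rw [c_comm]
        omega)
      change c _ _ = c _ _ at this
      rw [c_comm, this, c_comm]
    · simp only [List.length_cons] at i2 ⊢
      omega

lemma letters (hT : ∀ l m : ι × Bool, l.1 ≠ m.1 → ∃ ν ∈ K, IsMove ν l m) (hψ : Minim K ψ)
    (i : ι) : ∃ l, ψ⁻¹ (of i) = mk [l] := by
  set y := ψ⁻¹ (of i) with hy
  have hy' : ψ y = of i := by rw [hy]; exact MulAut.apply_inv_self _ _ _
  have hred : FreeGroup.IsReduced y.toWord := isReduced_toWord
  cases hw : y.toWord with
  | nil =>
    rw [toWord_eq_nil_iff] at hw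
    rw [hw, map_one] at hy'
    exact absurd hy'.symm (of_ne_one i)
  | cons d L =>
    rw [hw] at hred
    have := (main_len hT hψ L d hred d (by intro h; simpa using congrArg Prod.snd h)).2
    rw [← hw, mk_toWord, hy', norm_of, hw] at this
    simp at this
    have hL : L = [] := List.length_eq_zero_iff.mp (by omega)
    refine ⟨d, ?_⟩
    rw [← mk_toWord (x := y), hw, hL]

end main

theorem nielsen (K : Subgroup (MulAut (FreeGroup ι)))
    (hW : ∀ φ : MulAut (FreeGroup ι), (∀ i, ∃ l, φ (of i) = mk [l]) → φ ∈ K)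
    (hT : ∀ l m : ι × Bool, l.1 ≠ m.1 → ∃ ν ∈ K, IsMove ν l m) : K = ⊤ := by
  rw [eq_top_iff]
  intro φ _
  obtain ⟨ν, hν, hm⟩ := exists_minim (K := K) φ
  have h1 := hW _ (letters hT hm)
  have h2 := K.mul_mem (K.inv_mem h1) (K.inv_mem hν)
  simpa using h2

end NielsenRed


namespace IAGen

open FreeGroup (of)
open scoped commutatorElement

set_option linter.unusedSectionVars false
set_option linter.unusedVariables false

variable {ι : Type} [DecidableEq ι]

def S (i : ι) : Subgroup (FreeGroup ι) := Subgroup.closure {g | ∃ k, k ≠ i ∧ of k = g}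

lemma of_mem_S {i k : ι} (h : k ≠ i) : of k ∈ S i := Subgroup.subset_closure ⟨k, h, rfl⟩

lemma fix_S {i : ι} (φ : FreeGroup ι →* FreeGroup ι) (h : ∀ k, k ≠ i → φ (of k) = of k) :
    ∀ g ∈ S i, φ g = g := by
  intro g hg
  induction hg using Subgroup.closure_induction with
  | mem x hx => obtain ⟨k, hk, rfl⟩ := hx; exact h k hk
  | one => simp
  | mul x y _ _ hx hy => rw [map_mul, hx, hy]
  | inv x _ hx => rw [map_inv, hx]

lemma map_S {i j : ι} (φ : FreeGroup ι →* FreeGroup ι) (h : ∀ k, k ≠ i → φ (of k) ∈ S j) :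
    ∀ g ∈ S i, φ g ∈ S j := by
  intro g hg
  induction hg using Subgroup.closure_induction with
  | mem x hx => obtain ⟨k, hk, rfl⟩ := hx; exact h k hk
  | one => simp
  | mul x y _ _ hx hy => rw [map_mul]; exact mul_mem hx hy
  | inv x _ hx => rw [map_inv]; exact inv_mem hx

def Tend (i : ι) (a b : FreeGroup ι) : FreeGroup ι →* FreeGroup ι :=
  FreeGroup.lift (fun k => if k = i then a * of i * b else of k)

lemma Tend_self (i : ι) (a b : FreeGroup ι) : Tend i a b (of i) = a * of i * b := by
  simp [Tend]

lemma Tend_ne (a b : FreeGroup ι) {i k : ι} (h : k ≠ i) : Tend i a b (of k) = of k := by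
  simp [Tend, h]

lemma Tend_comp {i : ι} {a b : FreeGroup ι} (ha : a ∈ S i) (hb : b ∈ S i) :
    (Tend i a b).comp (Tend i a⁻¹ b⁻¹) = MonoidHom.id _ := by
  ext k
  by_cases h : k = i
  · subst h
    simp only [MonoidHom.comp_apply, Tend_self, map_mul, MonoidHom.id_apply]
    rw [fix_S _ (fun k hk => Tend_ne _ _ hk) _ (inv_mem ha),
      fix_S _ (fun k hk => Tend_ne _ _ hk) _ (inv_mem hb)]
    group
  · simp [Tend_ne _ _ h]

open Classical in
noncomputable def T (i : ι) (a b : FreeGroup ι) : MulAut (FreeGroup ι) :=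
  if h : a ∈ S i ∧ b ∈ S i then
    MonoidHom.toMulEquiv (Tend i a b) (Tend i a⁻¹ b⁻¹)
      (by have := Tend_comp (inv_mem h.1) (inv_mem h.2); rwa [inv_inv, inv_inv] at this)
      (Tend_comp h.1 h.2)
  else 1

lemma T_self {i : ι} {a b : FreeGroup ι} (ha : a ∈ S i) (hb : b ∈ S i) :
    T i a b (of i) = a * of i * b := by
  rw [T, dif_pos ⟨ha, hb⟩]
  exact Tend_self _ _ _

lemma T_ne {i k : ι} (a b : FreeGroup ι) (h : k ≠ i) : T i a b (of k) = of k := by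
  rw [T]
  split_ifs
  · exact Tend_ne _ _ h
  · rfl

lemma T_fix {i : ι} (a b : FreeGroup ι) {g : FreeGroup ι} (hg : g ∈ S i) : T i a b g = g :=
  fix_S (T i a b).toMonoidHom (fun k hk => T_ne a b hk) g hg

lemma aut_ext {φ ψ : MulAut (FreeGroup ι)} (h : ∀ k, φ (of k) = ψ (of k)) : φ = ψ := by
  have : φ.toMonoidHom = ψ.toMonoidHom := by
    ext k
    exact h k
  ext g
  exact DFunLike.congr_fun this g

lemma T_mul {i : ι} {a b a' b' : FreeGroup ι} (ha : a ∈ S i) (hb : b ∈ S i) (ha' : a' ∈ S i)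
    (hb' : b' ∈ S i) : T i a b * T i a' b' = T i (a' * a) (b * b') := by
  apply aut_ext
  intro k
  rw [MulAut.mul_apply]
  by_cases h : k = i
  · subst h
    rw [T_self ha' hb', map_mul, map_mul, T_fix _ _ ha', T_fix _ _ hb', T_self ha hb,
      T_self (mul_mem ha' ha) (mul_mem hb hb')]
    group
  · rw [T_ne _ _ h, T_ne _ _ h, T_ne _ _ h]

lemma T_one (i : ι) : T i 1 1 = 1 := by
  apply aut_ext
  intro k
  by_cases h : k = i
  · subst h
    rw [T_self (one_mem _) (one_mem _)]; simp
  · rw [T_ne _ _ h]; rfl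

lemma T_inv {i : ι} {a b : FreeGroup ι} (ha : a ∈ S i) (hb : b ∈ S i) :
    (T i a b)⁻¹ = T i a⁻¹ b⁻¹ := by
  apply inv_eq_of_mul_eq_one_right
  rw [T_mul ha hb (inv_mem ha) (inv_mem hb)]
  simp [T_one]

/-- conjugating `T` by an automorphism preserving the splitting. -/
lemma T_conj {i : ι} {a b : FreeGroup ι} (ha : a ∈ S i) (hb : b ∈ S i) (φ : MulAut (FreeGroup ι))
    (h1 : φ (of i) = of i) (h2 : ∀ k, k ≠ i → φ (of k) ∈ S i) :
    φ * T i a b = T i (φ a) (φ b) * φ := by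
  have h3 : ∀ g ∈ S i, φ g ∈ S i := map_S φ.toMonoidHom h2
  apply aut_ext
  intro k
  rw [MulAut.mul_apply, MulAut.mul_apply]
  by_cases h : k = i
  · subst h
    rw [T_self ha hb, h1, T_self (h3 _ ha) (h3 _ hb), map_mul, map_mul, h1]
  · rw [T_ne _ _ h, T_fix _ _ (h2 k h)]

variable [LinearOrder ι]

def Γ (ι : Type) [DecidableEq ι] [LinearOrder ι] : Subgroup (MulAut (FreeGroup ι)) :=
  Subgroup.closure ({g | ∃ i j, i ≠ j ∧ g = T i (of j) (of j)⁻¹} ∪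
    {g | ∃ i j k, i ≠ j ∧ i ≠ k ∧ j < k ∧ g = T i 1 ⁅of j, of k⁆})

lemma comm_in {G : Type} [Group G] (X : Set G) (C : Subgroup G)
    (hn : ∀ g ∈ Subgroup.closure X, ∀ c ∈ C, g * c * g⁻¹ ∈ C) (hX : ∀ x ∈ X, ∀ y ∈ X, ⁅x, y⁆ ∈ C) :
    ⁅Subgroup.closure X, Subgroup.closure X⁆ ≤ C := by
  have key : ∀ y, (∀ x ∈ X, ⁅x, y⁆ ∈ C) → ∀ g ∈ Subgroup.closure X, ⁅g, y⁆ ∈ C := by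
    intro y hy g hg
    induction hg using Subgroup.closure_induction with
    | mem x hx => exact hy x hx
    | one => simp
    | mul a b ha hb iha ihb =>
      have : ⁅a * b, y⁆ = (a * ⁅b, y⁆ * a⁻¹) * ⁅a, y⁆ := by simp only [commutatorElement_def]; group
      rw [this]
      exact mul_mem (hn a ha _ ihb) iha
    | inv a ha iha =>
      have : ⁅a⁻¹, y⁆ = a⁻¹ * ⁅a, y⁆⁻¹ * a⁻¹⁻¹ := by simp only [commutatorElement_def]; group
      rw [this]
      exact hn _ (inv_mem ha) _ (inv_mem iha)
  rw [Subgroup.commutator_le]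
  intro g hg h hh
  refine key h (fun x hx => ?_) g hg
  rw [← commutatorElement_inv]
  exact inv_mem (key x (fun z hz => hX z hz x hx) h hh)

section gens

variable {Q : Subgroup (MulAut (FreeGroup ι))} {i : ι}

lemma diag_mem (hQ : ∀ j, i ≠ j → T i (of j) (of j)⁻¹ ∈ Q) {g : FreeGroup ι} (hg : g ∈ S i) :
    T i g g⁻¹ ∈ Q := by
  induction hg using Subgroup.closure_induction with
  | mem x hx => obtain ⟨k, hk, rfl⟩ := hx; exact hQ k hk.symm
  | one => simp [T_one, one_mem]
  | mul x y hx hy ihx ihy =>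
    have := T_mul hy (inv_mem hy) hx (inv_mem hx)
    rw [← mul_inv_rev] at this
    rw [← this]
    exact mul_mem ihy ihx
  | inv x hx ihx =>
    rw [← T_inv hx (inv_mem hx)]
    exact inv_mem ihx

lemma comm_mem (hQ : ∀ j, i ≠ j → T i (of j) (of j)⁻¹ ∈ Q)
    (hQ' : ∀ j k, i ≠ j → i ≠ k → j < k → T i 1 ⁅of j, of k⁆ ∈ Q) {c : FreeGroup ι}
    (hc : c ∈ ⁅S i, S i⁆) : T i 1 c ∈ Q := by
  let C : Subgroup (FreeGroup ι) :=
    { carrier := {c | c ∈ S i ∧ T i 1 c ∈ Q}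
      one_mem' := ⟨one_mem _, by rw [T_one]; exact one_mem _⟩
      mul_mem' := by
        rintro a b ⟨ha, ha'⟩ ⟨hb, hb'⟩
        refine ⟨mul_mem ha hb, ?_⟩
        have := T_mul (one_mem _) ha (one_mem _) hb
        rw [mul_one] at this
        rw [← this]
        exact mul_mem ha' hb'
      inv_mem' := by
        rintro a ⟨ha, ha'⟩
        refine ⟨inv_mem ha, ?_⟩
        have := T_inv (one_mem _) ha
        rw [inv_one] at this
        rw [← this]
        exact inv_mem ha' }
  have : ⁅S i, S i⁆ ≤ C := by
    apply comm_in
    · rintro g hg c ⟨hc, hc'⟩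
      change g ∈ S i at hg
      refine ⟨mul_mem (mul_mem hg hc) (inv_mem hg), ?_⟩
      have e : T i 1 (g * c * g⁻¹) = T i g⁻¹ g⁻¹⁻¹ * T i 1 c * T i g g⁻¹ := by
        rw [inv_inv, T_mul (inv_mem hg) hg (one_mem _) hc, one_mul,
          T_mul (inv_mem hg) (mul_mem hg hc) hg (inv_mem hg), mul_inv_cancel]
      rw [e]
      exact mul_mem (mul_mem (diag_mem hQ (inv_mem hg)) hc') (diag_mem hQ hg)
    · rintro _ ⟨j, hj, rfl⟩ _ ⟨k, hk, rfl⟩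
      rcases lt_trichotomy j k with h | h | h
      · refine ⟨?_, hQ' j k hj.symm hk.symm h⟩
        simp only [commutatorElement_def]
        exact mul_mem (mul_mem (mul_mem (of_mem_S hj) (of_mem_S hk)) (inv_mem (of_mem_S hj)))
          (inv_mem (of_mem_S hk))
      · subst h; simp [one_mem]
      · rw [← commutatorElement_inv]
        apply inv_mem
        refine ⟨?_, hQ' k j hk.symm hj.symm h⟩
        simp only [commutatorElement_def]
        exact mul_mem (mul_mem (mul_mem (of_mem_S hk) (of_mem_S hj)) (inv_mem (of_mem_S hk)))
          (inv_mem (of_mem_S hj))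
  exact (this hc).2

end gens

lemma S_comm {i : ι} {c : FreeGroup ι} (hc : c ∈ S i) (h : Abelianization.of c = 1) :
    c ∈ ⁅S i, S i⁆ := by
  have h1 : c ∈ commutator (FreeGroup ι) := by
    rw [← Abelianization.ker_of]; exact h
  let r : FreeGroup ι →* FreeGroup ι := FreeGroup.lift (fun k => if k = i then 1 else of k)
  have hr : r c = c := fix_S r (fun k hk => by simp [r, hk]) c hc
  have hrange : ∀ g, r g ∈ S i := by
    intro g
    induction g using FreeGroup.induction_on with
    | C1 => simp [one_mem]
    | of k =>
      by_cases h : k = i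
      · simp [r, h, one_mem]
      · simpa [r, h] using of_mem_S h
    | inv_of k h => rw [map_inv]; exact inv_mem h
    | mul x y hx hy => rw [map_mul]; exact mul_mem hx hy
  have h2 : r c ∈ Subgroup.map r (commutator (FreeGroup ι)) := Subgroup.mem_map_of_mem r h1
  rw [commutator_def, Subgroup.map_commutator, hr] at h2
  have h3 : Subgroup.map r ⊤ ≤ S i := by
    rintro _ ⟨g, _, rfl⟩; exact hrange g
  exact Subgroup.commutator_mono h3 h3 h2

lemma K_mem {i j : ι} (h : i ≠ j) : T i (of j) (of j)⁻¹ ∈ Γ ι :=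
  Subgroup.subset_closure (Or.inl ⟨i, j, h, rfl⟩)

lemma good_mem {i : ι} {a b : FreeGroup ι} (ha : a ∈ S i) (hb : b ∈ S i)
    (h : Abelianization.of (a * b) = 1) : T i a b ∈ Γ ι := by
  have h1 := S_comm (mul_mem ha hb) h
  have h2 : T i a b = T i a a⁻¹ * T i 1 (a * b) := by
    rw [T_mul ha (inv_mem ha) (one_mem _) (mul_mem ha hb)]; simp
  rw [h2]
  refine mul_mem (diag_mem (fun j hj => K_mem hj) ha) (comm_mem (fun j hj => K_mem hj) ?_ h1)
  intro j k hj hk hjk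
  exact Subgroup.subset_closure (Or.inr ⟨i, j, k, hj, hk, hjk, rfl⟩)

end IAGen


namespace IAGen

open FreeGroup (of)
open scoped commutatorElement

set_option linter.unusedSectionVars false
set_option linter.unusedVariables false
set_option linter.unusedSimpArgs false

variable {ι : Type} [DecidableEq ι]

/-- signed permutations -/
def SP (ι : Type) : Subgroup (MulAut (FreeGroup ι)) where
  carrier := {φ | ∃ σ : Equiv.Perm ι, ∃ ε : ι → ℤ, (∀ i, ε i * ε i = 1) ∧
    ∀ i, φ (of i) = of (σ i) ^ ε i}
  one_mem' := ⟨1, fun _ => 1, by simp, by simp⟩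
  mul_mem' := by
    rintro φ ψ ⟨σ, ε, h1, h2⟩ ⟨τ, δ, h3, h4⟩
    refine ⟨σ * τ, fun i => ε (τ i) * δ i, fun i => ?_, fun i => ?_⟩
    · calc _ = (ε (τ i) * ε (τ i)) * (δ i * δ i) := by ring
        _ = 1 := by rw [h1, h3, mul_one]
    · rw [MulAut.mul_apply, h4, map_zpow, h2, ← zpow_mul]; rfl
  inv_mem' := by
    rintro φ ⟨σ, ε, h1, h2⟩
    refine ⟨σ⁻¹, fun i => ε (σ⁻¹ i), fun i => h1 _, fun i => ?_⟩
    apply φ.injective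
    rw [MulAut.apply_inv_self, map_zpow, h2, ← zpow_mul, h1]
    simp

lemma sign_cases {e : ℤ} (h : e * e = 1) : e = 1 ∨ e = -1 := by
  exact mul_self_eq_one_iff.mp h

lemma mk_letter (l : ι × Bool) : FreeGroup.mk [l] = of l.1 ^ (if l.2 then (1 : ℤ) else -1) := by
  rcases l with ⟨i, b⟩
  cases b
  · simp [FreeGroup.of, FreeGroup.inv_mk, FreeGroup.invRev]
  · simp [FreeGroup.of]

lemma SP_of_letters [Fintype ι] {φ : MulAut (FreeGroup ι)}
    (h : ∀ i, ∃ l, φ (of i) = FreeGroup.mk [l]) : φ ∈ SP ι := by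
  choose l hl using h
  simp only [mk_letter] at hl
  set ε : ι → ℤ := fun i => if (l i).2 then (1 : ℤ) else -1 with hε
  have h1 : ∀ i, ε i * ε i = 1 := by
    intro i; simp only [hε]; split_ifs <;> rfl
  have hinj : Function.Injective (fun i => (l i).1) := by
    intro i j hij
    simp only at hij
    have h2 : φ (of i) = φ (of j ^ (ε j * ε i)) := by
      rw [map_zpow, hl, hl, ← zpow_mul, hij, ← mul_assoc]
      change _ ^ (ε i) = _ ^ (ε j * ε j * ε i)
      rw [h1, one_mul]
    have h3 := φ.injective h2
    by_contra hne
    have h4 := congrArg (FreeGroup.lift (fun k => if k = i then Multiplicative.ofAdd (1 : ℤ) else 1)) h3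
    simp [Ne.symm hne] at h4
  exact ⟨Equiv.ofBijective _ (Finite.injective_iff_bijective.mp hinj), ε, h1, hl⟩

lemma SP_conj {φ : MulAut (FreeGroup ι)} {σ : Equiv.Perm ι} {ε : ι → ℤ} (h1 : ∀ i, ε i * ε i = 1)
    (h2 : ∀ i, φ (of i) = of (σ i) ^ ε i) {i : ι} {a b : FreeGroup ι} (ha : a ∈ S i) (hb : b ∈ S i) :
    φ a ∈ S (σ i) ∧ φ b ∈ S (σ i) ∧ (
    (ε i = 1 ∧ φ * T i a b = T (σ i) (φ a) (φ b) * φ) ∨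
    (ε i = -1 ∧ φ * T i a b = T (σ i) (φ b)⁻¹ (φ a)⁻¹ * φ)) := by
  have h3 : ∀ g ∈ S i, φ g ∈ S (σ i) := map_S φ.toMonoidHom (fun k hk => by
    change φ (of k) ∈ _
    rw [h2]
    exact zpow_mem (of_mem_S (σ.injective.ne hk)) _)
  refine ⟨h3 a ha, h3 b hb, ?_⟩
  rcases sign_cases (h1 i) with h | h
  · refine Or.inl ⟨h, ?_⟩
    apply aut_ext
    intro k
    rw [MulAut.mul_apply, MulAut.mul_apply]
    by_cases hk : k = i
    · subst hk
      rw [T_self ha hb, map_mul, map_mul, h2, map_zpow, T_self (h3 _ ha) (h3 _ hb), h]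
      simp
    · rw [T_ne _ _ hk, h2, map_zpow, T_ne _ _ (σ.injective.ne hk)]
  · refine Or.inr ⟨h, ?_⟩
    apply aut_ext
    intro k
    rw [MulAut.mul_apply, MulAut.mul_apply]
    by_cases hk : k = i
    · subst hk
      rw [T_self ha hb, map_mul, map_mul, h2, map_zpow,
        T_self (inv_mem (h3 _ hb)) (inv_mem (h3 _ ha)), h]
      group
    · rw [T_ne _ _ hk, h2, map_zpow, T_ne _ _ (σ.injective.ne hk)]

/-- sign change -/
def flipHom (i : ι) : FreeGroup ι →* FreeGroup ι :=
  FreeGroup.lift (fun k => if k = i then (of i)⁻¹ else of k)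

def flipAut (i : ι) : MulAut (FreeGroup ι) :=
  have h : (flipHom i).comp (flipHom i) = MonoidHom.id _ := by
    ext k
    by_cases h : k = i
    · subst h; simp [flipHom]
    · simp [flipHom, h]
  MonoidHom.toMulEquiv (flipHom i) (flipHom i) h h

lemma flip_self (i : ι) : flipAut i (of i) = (of i)⁻¹ := by
  change flipHom i (of i) = _
  simp [flipHom]

lemma flip_ne {i k : ι} (h : k ≠ i) : flipAut i (of k) = of k := by
  change flipHom i (of k) = _
  simp [flipHom, h]

lemma flip_zpow (i k : ι) : flipAut i (of k) = of k ^ (if k = i then (-1 : ℤ) else 1) := by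
  by_cases h : k = i
  · subst h; simp [flip_self]
  · simp [flip_ne h, h]

lemma flip_mem (i : ι) : flipAut i ∈ SP ι := by
  refine ⟨1, fun k => if k = i then -1 else 1, fun k => ?_, fun k => ?_⟩
  · by_cases h : k = i <;> simp [h]
  · rw [flip_zpow]; rfl

variable [LinearOrder ι]

lemma ab_map (φ : MulAut (FreeGroup ι)) {g : FreeGroup ι} (h : Abelianization.of g = 1) :
    Abelianization.of (φ g) = 1 := by
  have := Abelianization.map_of φ.toMonoidHom g
  change _ = Abelianization.of (φ g) at this
  rw [← this, h, map_one]

/-- elements whose conjugation preserves `Γ`. -/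
def Stab (ι : Type) [DecidableEq ι] [LinearOrder ι] : Submonoid (MulAut (FreeGroup ι)) where
  carrier := {φ | ∀ g ∈ Γ ι, φ * g * φ⁻¹ ∈ Γ ι}
  one_mem' := by intro g hg; simpa using hg
  mul_mem' := by
    intro a b ha hb g hg
    have := ha _ (hb g hg)
    simpa [mul_assoc] using this

lemma stab_of_gens {φ : MulAut (FreeGroup ι)}
    (h1 : ∀ i j, i ≠ j → ∃ f ∈ Γ ι, φ * T i (of j) (of j)⁻¹ = f * φ)
    (h2 : ∀ i j k, i ≠ j → i ≠ k → j < k → ∃ f ∈ Γ ι, φ * T i 1 ⁅of j, of k⁆ = f * φ) :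
    φ ∈ Stab ι := by
  intro g hg
  have : Γ ι ≤ (Γ ι).comap (MulAut.conj φ).toMonoidHom := by
    conv_lhs => rw [Γ]
    rw [Subgroup.closure_le]
    rintro g (⟨i, j, hij, rfl⟩ | ⟨i, j, k, hij, hik, hjk, rfl⟩)
    · obtain ⟨f, hf, e⟩ := h1 i j hij
      change φ * _ * φ⁻¹ ∈ Γ ι
      rw [e]; simpa using hf
    · obtain ⟨f, hf, e⟩ := h2 i j k hij hik hjk
      change φ * _ * φ⁻¹ ∈ Γ ι
      rw [e]; simpa using hf
  exact this hg

lemma comm_S {i j k : ι} (hij : i ≠ j) (hik : i ≠ k) : ⁅of j, of k⁆ ∈ S i := by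
  simp only [commutatorElement_def]
  exact mul_mem (mul_mem (mul_mem (of_mem_S hij.symm) (of_mem_S hik.symm))
    (inv_mem (of_mem_S hij.symm))) (inv_mem (of_mem_S hik.symm))

lemma comm_ab (x y : FreeGroup ι) : Abelianization.of ⁅x, y⁆ = 1 := by
  simp [commutatorElement_def, mul_comm]

lemma stab_of_good {φ : MulAut (FreeGroup ι)}
    (h : ∀ i a b, a ∈ S i → b ∈ S i → Abelianization.of (a * b) = 1 →
      ∃ f ∈ Γ ι, φ * T i a b = f * φ) : φ ∈ Stab ι := by
  apply stab_of_gens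
  · intro i j hij
    exact h i _ _ (of_mem_S hij.symm) (inv_mem (of_mem_S hij.symm)) (by simp)
  · intro i j k hij hik hjk
    exact h i _ _ (one_mem _) (comm_S hij hik) (by rw [one_mul, comm_ab])

lemma SP_stab {φ : MulAut (FreeGroup ι)} (h : φ ∈ SP ι) : φ ∈ Stab ι := by
  obtain ⟨σ, ε, h1, h2⟩ := h
  apply stab_of_good
  intro i a b ha hb hab
  obtain ⟨ha', hb', (⟨_, h⟩ | ⟨_, h⟩)⟩ := SP_conj h1 h2 ha hb
  · refine ⟨_, good_mem ha' hb' ?_, h⟩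
    rw [← map_mul]; exact ab_map φ hab
  · refine ⟨_, good_mem (inv_mem hb') (inv_mem ha') ?_, h⟩
    rw [← mul_inv_rev, ← map_mul, map_inv, ab_map φ hab, inv_one]

/-- the hard case -/
lemma hard_K {i j k : ι} (hki : k ≠ i) (hij : i ≠ j) :
    ∃ f ∈ Γ ι, T k 1 (of i) * T i (of j) (of j)⁻¹ = f * T k 1 (of i) := by
  have hi := of_mem_S hki.symm
  have hk := of_mem_S hki
  have hj := of_mem_S hij.symm
  by_cases hjk : j = k
  · subst hjk
    refine ⟨T i (of j) (of j)⁻¹ * T j (of i) (of i)⁻¹, mul_mem (K_mem hij) (K_mem hki), ?_⟩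
    apply aut_ext
    intro m
    simp only [MulAut.mul_apply]
    by_cases h1 : m = i
    · subst h1
      simp only [T_self hj (inv_mem hj), T_self (one_mem _) hi, T_ne _ _ hki.symm, map_mul, map_inv]
      group
    · by_cases h2 : m = j
      · subst h2
        simp only [T_self hj (inv_mem hj), T_self (one_mem _) hi, T_self hi (inv_mem hi), T_ne _ _ hki.symm,
          T_ne _ _ hki, map_mul, map_inv, map_one]
        group
      · simp only [T_ne _ _ h1, T_ne _ _ h2]
  · have hjk' := of_mem_S hjk
    have hc : of i * of j * (of i)⁻¹ * (of j)⁻¹ ∈ S k :=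
      mul_mem (mul_mem (mul_mem hi hjk') (inv_mem hi)) (inv_mem hjk')
    refine ⟨T k 1 (of i * of j * (of i)⁻¹ * (of j)⁻¹) * T i (of j) (of j)⁻¹,
      mul_mem (good_mem (one_mem _) hc ?_) (K_mem hij), ?_⟩
    · simp [mul_comm]
    apply aut_ext
    intro m
    simp only [MulAut.mul_apply]
    by_cases h1 : m = i
    · subst h1
      simp only [T_self hj (inv_mem hj), T_self (one_mem _) hi, T_ne _ _ hki.symm, map_mul, map_inv,
        T_ne _ _ hjk]
    · by_cases h2 : m = k
      · subst h2
        simp only [T_self hj (inv_mem hj), T_self (one_mem _) hi, T_self (one_mem _) hc, T_ne _ _ hki.symm,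
          T_ne _ _ hki, map_mul, map_inv, map_one, T_ne _ _ hjk]
        group
      · simp only [T_ne _ _ h1, T_ne _ _ h2]

lemma hard_M {i k : ι} {c : FreeGroup ι} (hki : k ≠ i) (hc : c ∈ S i) (hc' : c ∈ S k)
    (hab : Abelianization.of c = 1) :
    ∃ f ∈ Γ ι, T k 1 (of i) * T i 1 c = f * T k 1 (of i) := by
  have hi := of_mem_S hki.symm
  have hd : of i * c⁻¹ * (of i)⁻¹ ∈ S k := mul_mem (mul_mem hi (inv_mem hc')) (inv_mem hi)
  refine ⟨T k 1 (of i * c⁻¹ * (of i)⁻¹) * T i 1 c,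
      mul_mem (good_mem (one_mem _) hd ?_) (good_mem (one_mem _) hc (by simpa using hab)), ?_⟩
  · simp [hab]
  apply aut_ext
  intro m
  simp only [MulAut.mul_apply]
  by_cases h1 : m = i
  · subst h1
    simp only [T_self (one_mem _) hc, T_ne _ _ hki.symm, map_mul, map_one, T_fix _ _ hc']
  · by_cases h2 : m = k
    · subst h2
      simp only [T_self (one_mem _) hi, T_self (one_mem _) hd, T_self (one_mem _) hc, T_ne _ _ hki.symm,
          T_ne _ _ hki, map_mul, map_inv, map_one, T_fix _ _ hc']
      group
    · simp only [T_ne _ _ h1, T_ne _ _ h2]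

lemma hard_h {i j k : ι} (hki : k ≠ i) (hij : i ≠ j) (hjk : j ≠ k) :
    ∃ f ∈ Γ ι, T k 1 (of i) * T i ((of j)⁻¹ * (of k)⁻¹) (of j * of k) = f * T k 1 (of i) := by
  have hi := of_mem_S hki.symm
  have hk := of_mem_S hki
  have hj := of_mem_S hij.symm
  have hjk' := of_mem_S hjk
  have ha : (of j)⁻¹ * (of k)⁻¹ ∈ S i := mul_mem (inv_mem hj) (inv_mem hk)
  have hb : of j * of k ∈ S i := mul_mem hj hk
  have hd : of i * of j ∈ S k := mul_mem hi hjk'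
  have he : of j * of k * (of j)⁻¹ ∈ S i := mul_mem hb (inv_mem hj)
  refine ⟨T k (of i * of j)⁻¹ (of i * of j) * T i (of k)⁻¹ (of j * of k * (of j)⁻¹),
      mul_mem (good_mem (inv_mem hd) hd (by simp)) (good_mem (inv_mem hk) he (by simp)), ?_⟩
  apply aut_ext
  intro m
  simp only [MulAut.mul_apply]
  by_cases h1 : m = i
  · subst h1
    simp only [T_self ha hb, T_self (one_mem _) hi, T_self (inv_mem hk) he, T_self (inv_mem hd) hd,
      T_ne _ _ hki.symm, T_ne _ _ hki, T_ne _ _ hjk, map_mul, map_inv]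
    group
  · by_cases h2 : m = k
    · subst h2
      simp only [T_self ha hb, T_self (one_mem _) hi, T_self (inv_mem hk) he, T_self (inv_mem hd) hd,
        T_ne _ _ hki.symm, T_ne _ _ hki, T_ne _ _ hjk, map_mul, map_inv, map_one]
      group
    · simp only [T_ne _ _ h1, T_ne _ _ h2]

lemma hard_M' {i j k : ι} (hki : k ≠ i) (hij : i ≠ j) (hjk : j ≠ k) :
    ∃ f ∈ Γ ι, T k 1 (of i) * T i 1 ⁅of j, of k⁆ = f * T k 1 (of i) := by
  have hk := of_mem_S hki
  have hj := of_mem_S hij.symm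
  obtain ⟨f, hf, e⟩ := hard_h hki hij hjk
  have hQ : T i (of k * of j) (of k * of j)⁻¹ ∈ (Γ ι).comap (MulAut.conj (T k 1 (of i))).toMonoidHom := by
    apply diag_mem _ (mul_mem hk hj)
    intro l hl
    obtain ⟨f, hf, e⟩ := hard_K hki hl
    change T k 1 (of i) * _ * (T k 1 (of i))⁻¹ ∈ Γ ι
    rw [e]; simpa using hf
  change T k 1 (of i) * _ * (T k 1 (of i))⁻¹ ∈ Γ ι at hQ
  refine ⟨f * _, mul_mem hf hQ, ?_⟩
  have e2 : T i 1 ⁅of j, of k⁆ = T i ((of j)⁻¹ * (of k)⁻¹) (of j * of k) *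
      T i (of k * of j) (of k * of j)⁻¹ := by
    rw [T_mul (mul_mem (inv_mem hj) (inv_mem hk)) (mul_mem hj hk) (mul_mem hk hj)
      (inv_mem (mul_mem hk hj))]
    congr 1
    · group
  rw [e2, ← mul_assoc, e]
  simp only [mul_assoc, inv_mul_cancel, mul_one]

lemma move_stab {k l : ι} (hkl : k ≠ l) : T k 1 (of l) ∈ Stab ι := by
  have hl := of_mem_S hkl.symm
  apply stab_of_gens
  · intro i j hij
    have hj := of_mem_S hij.symm
    by_cases h1 : i = k
    · subst h1
      refine ⟨T i (of j) (of l * (of j)⁻¹ * (of l)⁻¹), good_mem hj (mul_mem (mul_mem hl (inv_mem hj)) (inv_mem hl)) (by simp), ?_⟩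
      rw [T_mul (one_mem _) hl hj (inv_mem hj), T_mul hj (mul_mem (mul_mem hl (inv_mem hj)) (inv_mem hl)) (one_mem _) hl]
      simp
    · by_cases h2 : i = l
      · subst h2
        exact hard_K hkl hij
      · have h3 : ∀ m, m ≠ i → T k 1 (of l) (of m) ∈ S i := by
          intro m hm
          by_cases hmk : m = k
          · subst hmk; rw [T_self (one_mem _) hl, one_mul]
            exact mul_mem (of_mem_S hm) (of_mem_S (Ne.symm h2))
          · rw [T_ne _ _ hmk]; exact of_mem_S hm
        have h4 := map_S (T k 1 (of l)).toMonoidHom h3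
        refine ⟨_, good_mem (h4 _ hj) (h4 _ (inv_mem hj)) ?_, T_conj hj (inv_mem hj) _ (T_ne _ _ h1) h3⟩
        rw [← map_mul]; simp
  · intro i j m hij him hjm
    have hc := comm_S hij him
    by_cases h1 : i = k
    · subst h1
      refine ⟨T i 1 (of l * ⁅of j, of m⁆ * (of l)⁻¹), good_mem (one_mem _) (mul_mem (mul_mem hl hc) (inv_mem hl)) (by
        rw [one_mul, map_mul, map_mul, comm_ab]; simp), ?_⟩
      rw [T_mul (one_mem _) hl (one_mem _) hc, T_mul (one_mem _) (mul_mem (mul_mem hl hc) (inv_mem hl)) (one_mem _) hl]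
      simp
    · by_cases h2 : i = l
      · subst h2
        by_cases h3 : j = k
        · subst h3
          obtain ⟨f, hf, e⟩ := hard_M' hkl him hjm.ne'
          refine ⟨f⁻¹, inv_mem hf, ?_⟩
          have e2 : T i 1 ⁅of j, of m⁆ = (T i 1 ⁅of m, of j⁆)⁻¹ := by
            rw [T_inv (one_mem _) (comm_S him hij)]; simp
          rw [e2, eq_inv_mul_iff_mul_eq, ← mul_assoc, ← e]; simp
        · by_cases h4 : m = k
          · subst h4
            exact hard_M' hkl hij hjm.ne
          · exact hard_M hkl hc (comm_S (Ne.symm h3) (Ne.symm h4)) (comm_ab _ _)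
      · have h3 : ∀ m, m ≠ i → T k 1 (of l) (of m) ∈ S i := by
          intro m hm
          by_cases hmk : m = k
          · subst hmk; rw [T_self (one_mem _) hl, one_mul]
            exact mul_mem (of_mem_S hm) (of_mem_S (Ne.symm h2))
          · rw [T_ne _ _ hmk]; exact of_mem_S hm
        have h4 := map_S (T k 1 (of l)).toMonoidHom h3
        refine ⟨_, good_mem (h4 _ (one_mem _)) (h4 _ hc) ?_, T_conj (one_mem _) hc _ (T_ne _ _ h1) h3⟩
        rw [← map_mul, one_mul]; exact ab_map (T k 1 (of l)) (comm_ab _ _)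

lemma flip_move {k l : ι} (hkl : k ≠ l) (a : ℤ) :
    flipAut l * T k 1 (of l ^ a) = T k 1 (of l ^ (-a)) * flipAut l := by
  have hl := of_mem_S hkl.symm
  rw [T_conj (one_mem _) (zpow_mem hl _) _ (flip_ne hkl), map_one, map_zpow, flip_self]
  · simp
  · intro m hm
    rw [flip_zpow]; exact zpow_mem (of_mem_S hm) _

/-- the subgroup normalizing `Γ`. -/
def Nrm (ι : Type) [DecidableEq ι] [LinearOrder ι] : Subgroup (MulAut (FreeGroup ι)) where
  carrier := {φ | φ ∈ Stab ι ∧ φ⁻¹ ∈ Stab ι}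
  one_mem' := ⟨one_mem _, by rw [inv_one]; exact one_mem _⟩
  mul_mem' := by
    rintro a b ⟨ha, ha'⟩ ⟨hb, hb'⟩
    exact ⟨mul_mem ha hb, by rw [mul_inv_rev]; exact mul_mem hb' ha'⟩
  inv_mem' := by
    rintro a ⟨ha, ha'⟩
    exact ⟨ha', by rwa [inv_inv]⟩

lemma SP_nrm {φ : MulAut (FreeGroup ι)} (h : φ ∈ SP ι) : φ ∈ Nrm ι :=
  ⟨SP_stab h, SP_stab (inv_mem h)⟩

lemma move_nrm {k l : ι} (hkl : k ≠ l) : T k 1 (of l) ∈ Nrm ι := by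
  refine ⟨move_stab hkl, ?_⟩
  have h1 := flip_move hkl 1
  rw [T_inv (one_mem _) (of_mem_S hkl.symm)]
  have h2 : T k 1⁻¹ (of l)⁻¹ = flipAut l * T k 1 (of l) * (flipAut l)⁻¹ := by
    rw [eq_mul_inv_iff_mul_eq]
    simpa using h1.symm
  rw [h2]
  exact mul_mem (mul_mem (SP_stab (flip_mem l)) (move_stab hkl)) (SP_stab (inv_mem (flip_mem l)))

/-- A subgroup containing the signed permutations and the elementary moves is everything. -/
lemma gen_top [Fintype ι] (K : Subgroup (MulAut (FreeGroup ι))) (h1 : SP ι ≤ K)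
    (h2 : ∀ k l, k ≠ l → T k 1 (of l) ∈ K) : K = ⊤ := by
  apply NielsenRed.nielsen
  · intro φ h
    exact h1 (SP_of_letters h)
  · rintro ⟨i, b⟩ ⟨j, b'⟩ hij
    simp only at hij
    have hj := of_mem_S hij.symm
    have hz : ∀ a : ℤ, T i 1 (of j ^ a) ∈ K := by
      intro a
      have : T i 1 (of j ^ a) = T i 1 (of j) ^ a := by
        have hn : ∀ n : ℕ, T i 1 (of j ^ n) = T i 1 (of j) ^ n := by
          intro n
          induction n with
          | zero => simp [T_one]
          | succ n ih =>
            rw [pow_succ, pow_succ, ← ih, T_mul (one_mem _) (pow_mem hj _) (one_mem _) hj]; simp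
        rcases Int.eq_nat_or_neg a with ⟨n, rfl | rfl⟩
        · simpa using hn n
        · rw [zpow_neg, zpow_neg, zpow_natCast, zpow_natCast, ← hn, T_inv (one_mem _) (pow_mem hj _)]
          simp
      rw [this]
      exact zpow_mem (h2 i j hij) a
    have hm : ∀ e : ℤ, e = 1 ∨ e = -1 → ∃ ν ∈ K, ν (of i ^ e) = of i ^ e * FreeGroup.mk [(j, b')] ∧
        ∀ k, k ≠ i → ν (of k) = of k := by
      rintro e (rfl | rfl)
      · refine ⟨_, hz (if b' then 1 else -1), ?_, fun k hk => T_ne _ _ hk⟩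
        rw [zpow_one, T_self (one_mem _) (zpow_mem hj _), mk_letter]; simp
      · refine ⟨flipAut i * T i 1 (of j ^ (if b' then (1 : ℤ) else -1)) * flipAut i,
          mul_mem (mul_mem (h1 (flip_mem i)) (hz _)) (h1 (flip_mem i)), ?_, ?_⟩
        · simp only [MulAut.mul_apply, map_zpow, flip_self, map_inv]
          rw [T_self (one_mem _) (zpow_mem hj _), mk_letter]
          cases b' <;> simp [flip_self, flip_ne hij.symm]
        · intro k hk
          simp only [MulAut.mul_apply, flip_ne hk, T_ne _ _ hk]
    obtain ⟨ν, hν, e1, e2⟩ := hm (if b then 1 else -1) (by cases b <;> simp)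
    refine ⟨ν, hν, ?_, ?_⟩
    · rw [mk_letter (i, b)]; exact e1
    · rintro ⟨k, d⟩ hk
      rw [mk_letter, map_zpow, e2 k hk]

lemma normal_Γ [Fintype ι] : (Γ ι).Normal := by
  have h := gen_top (Nrm ι) (fun φ h => SP_nrm h) (fun k l h => move_nrm h)
  constructor
  intro g hg φ
  have : φ ∈ Nrm ι := by rw [h]; trivial
  exact this.1 g hg

end IAGen


namespace IAGen

open FreeGroup (of)
open scoped commutatorElement

set_option linter.unusedSectionVars false
set_option linter.unusedVariables false
set_option linter.unusedSimpArgs false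

variable {ι : Type} [DecidableEq ι]

def abm (ι : Type) [DecidableEq ι] : FreeGroup ι →* Multiplicative (ι → ℤ) :=
  FreeGroup.lift (fun i => Multiplicative.ofAdd (Pi.single i (1 : ℤ)))

def abv (g : FreeGroup ι) : ι → ℤ := Multiplicative.toAdd (abm ι g)

lemma abv_mul (g h : FreeGroup ι) : abv (g * h) = abv g + abv h := by
  simp [abv]
lemma abv_one : abv (1 : FreeGroup ι) = 0 := by
  simp [abv]
lemma abv_inv (g : FreeGroup ι) : abv g⁻¹ = - abv g := by
  simp [abv]
lemma abv_zpow (g : FreeGroup ι) (a : ℤ) : abv (g ^ a) = a • abv g := by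
  simp [abv]
lemma abv_of (i : ι) : abv (of i) = Pi.single i 1 := by
  simp [abv, abm]

lemma abv_eq {g h : FreeGroup ι} (e : Abelianization.of g = Abelianization.of h) : abv g = abv h := by
  have h1 : ∀ x, abm ι x = Abelianization.lift (abm ι) (Abelianization.of x) := fun x => by
    rw [Abelianization.lift_apply_of]
  unfold abv
  rw [h1, h1, e]

variable [Fintype ι]

def act (φ : MulAut (FreeGroup ι)) (v : ι → ℤ) : ι → ℤ := ∑ k, v k • abv (φ (of k))

lemma act_add (φ : MulAut (FreeGroup ι)) (v w : ι → ℤ) : act φ (v + w) = act φ v + act φ w := by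
  simp [act, add_mul, add_smul, Finset.sum_add_distrib]

lemma act_smul (φ : MulAut (FreeGroup ι)) (a : ℤ) (v : ι → ℤ) : act φ (a • v) = a • act φ v := by
  simp [act, Finset.mul_sum, mul_assoc]

def actL (φ : MulAut (FreeGroup ι)) : (ι → ℤ) →ₗ[ℤ] (ι → ℤ) where
  toFun := act φ
  map_add' := act_add φ
  map_smul' := act_smul φ

lemma act_single (φ : MulAut (FreeGroup ι)) (i : ι) : act φ (Pi.single i 1) = abv (φ (of i)) := by
  unfold act
  rw [Finset.sum_eq_single i]
  · simp
  · intro b _ hb; simp [hb]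
  · simp

lemma act_abv (φ : MulAut (FreeGroup ι)) (g : FreeGroup ι) : act φ (abv g) = abv (φ g) := by
  have : ∀ a : ι → ℤ, act φ (-a) = - act φ a := fun a => (actL φ).map_neg a
  have h0 : act φ 0 = 0 := (actL φ).map_zero
  induction g using FreeGroup.induction_on with
  | C1 => simp [abv_one, h0]
  | of k => rw [abv_of, act_single]
  | inv_of k h => rw [map_inv, abv_inv, abv_inv, this, h]
  | mul x y hx hy => rw [map_mul, abv_mul, abv_mul, act_add, hx, hy]

lemma act_mul (φ ψ : MulAut (FreeGroup ι)) (v : ι → ℤ) : act (φ * ψ) v = act φ (act ψ v) := by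
  have h : act φ (act ψ v) = actL φ (∑ k, v k • abv (ψ (of k))) := rfl
  rw [h, map_sum]
  unfold act
  apply Finset.sum_congr rfl
  intro k _
  rw [map_zsmul]
  congr 1
  exact (act_abv φ _).symm

lemma act_one (v : ι → ℤ) : act 1 v = v := by
  unfold act
  simp only [MulAut.one_apply, abv_of]
  ext j
  simp [Finset.sum_apply, Pi.single_apply]

def actPerm (ι : Type) [DecidableEq ι] [Fintype ι] :
    MulAut (FreeGroup ι) →* Equiv.Perm (ι → ℤ) where
  toFun φ := ⟨act φ, act φ⁻¹, fun v => by rw [← act_mul]; simp [act_one],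
    fun v => by rw [← act_mul]; simp [act_one]⟩
  map_one' := by ext v : 1; exact act_one v
  map_mul' φ ψ := by ext v : 1; exact act_mul φ ψ v

lemma actPerm_apply (φ : MulAut (FreeGroup ι)) (v) : actPerm ι φ v = act φ v := rfl

lemma act_eq_one {φ : MulAut (FreeGroup ι)} (h : ∀ i, abv (φ (of i)) = abv (of i)) :
    actPerm ι φ = 1 := by
  ext v : 1
  rw [actPerm_apply]
  change _ = v
  conv_rhs => rw [← act_one v]
  unfold act
  apply Finset.sum_congr rfl
  intro k _
  rw [h]; rfl

variable [LinearOrder ι]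

lemma Γ_le : Γ ι ≤ (actPerm ι).ker := by
  rw [Γ, Subgroup.closure_le]
  rintro g (⟨i, j, hij, rfl⟩ | ⟨i, j, k, hij, hik, hjk, rfl⟩)
  · apply act_eq_one
    intro m
    by_cases h : m = i
    · subst h
      rw [T_self (of_mem_S hij.symm) (inv_mem (of_mem_S hij.symm))]
      simp [abv_mul, abv_inv]
    · rw [T_ne _ _ h]
  · apply act_eq_one
    intro m
    by_cases h : m = i
    · subst h
      rw [T_self (one_mem _) (comm_S hij hik)]
      simp only [commutatorElement_def, abv_mul, abv_inv, abv_one]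
      abel
    · rw [T_ne _ _ h]

lemma T_congr {i : ι} {a b a' b' : FreeGroup ι} (ha : a ∈ S i) (hb : b ∈ S i) (ha' : a' ∈ S i)
    (hb' : b' ∈ S i) (h : Abelianization.of (a * b) = Abelianization.of (a' * b')) :
    (QuotientGroup.mk (T i a b) : MulAut (FreeGroup ι) ⧸ Γ ι) = QuotientGroup.mk (T i a' b') := by
  rw [QuotientGroup.eq, T_inv ha hb, T_mul (inv_mem ha) (inv_mem hb) ha' hb']
  apply good_mem (mul_mem ha' (inv_mem ha)) (mul_mem (inv_mem hb) hb')
  rw [map_mul, map_mul] at h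
  simp only [map_mul, map_inv]
  calc _ = (Abelianization.of a' * Abelianization.of b') *
        (Abelianization.of a * Abelianization.of b)⁻¹ := by
        rw [mul_inv]; ac_rfl
    _ = 1 := by rw [h, mul_inv_cancel]

instance : (Γ ι).Normal := normal_Γ

noncomputable def glData (ι : Type) [DecidableEq ι] [Fintype ι] [LinearOrder ι] :
    GLData ι (MulAut (FreeGroup ι) ⧸ Γ ι) where
  ρ := QuotientGroup.lift (Γ ι) (actPerm ι) Γ_le
  E i j a := QuotientGroup.mk (T i 1 (of j ^ a))
  W := (SP ι).map (QuotientGroup.mk' (Γ ι))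
  E_add := by
    intro i j hij a b
    have hj := of_mem_S hij.symm
    rw [← QuotientGroup.mk_mul, T_mul (one_mem _) (zpow_mem hj _) (one_mem _) (zpow_mem hj _), zpow_add]
    simp
  ρE := by
    intro i j hij a v
    have hj := of_mem_S hij.symm
    change act _ v = _
    have h1 : ∀ k, abv (T i 1 (of j ^ a) (of k)) = abv (of k) + if k = i then a • abv (of j) else 0 := by
      intro k
      by_cases h : k = i
      · subst h
        rw [T_self (one_mem _) (zpow_mem hj _)]
        simp [abv_mul, abv_zpow, abv_one]
      · rw [T_ne _ _ h]; simp [h]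
    have h2 : act (T i 1 (of j ^ a)) v = v + (v i * a) • abv (of j) := by
      have h3 := act_one v
      unfold act at h3 ⊢
      simp only [MulAut.one_apply] at h3
      simp only [h1, smul_add, Finset.sum_add_distrib, h3]
      congr 1
      rw [Finset.sum_eq_single i]
      · simp only [if_true, smul_smul]
      · intro b _ hb; simp only [hb, if_false, smul_zero]
      · simp
    rw [h2, abv_of]
    ext k
    by_cases h : k = j
    · subst h; simp; ring
    · simp [h]
  comm := by
    intro i j k l hij hkl hjk hil a b
    have hj := of_mem_S hij.symm
    have hl := of_mem_S hkl.symm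
    rw [← QuotientGroup.mk_mul, ← QuotientGroup.mk_mul]
    by_cases hik : i = k
    · subst hik
      rw [T_mul (one_mem _) (zpow_mem hj _) (one_mem _) (zpow_mem hl _),
        T_mul (one_mem _) (zpow_mem hl _) (one_mem _) (zpow_mem hj _)]
      apply T_congr (mul_mem (one_mem _) (one_mem _)) (mul_mem (zpow_mem hj _) (zpow_mem hl _))
        (mul_mem (one_mem _) (one_mem _)) (mul_mem (zpow_mem hl _) (zpow_mem hj _))
      simp [mul_comm]
    · congr 1
      apply aut_ext
      intro m
      simp only [MulAut.mul_apply]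
      by_cases h1 : m = i
      · subst h1
        simp only [T_self (one_mem _) (zpow_mem hj _), T_ne _ _ hik, map_mul, map_zpow, map_one, T_ne _ _ hjk]
      · by_cases h2 : m = k
        · subst h2
          simp only [T_self (one_mem _) (zpow_mem hl _), T_ne _ _ h1, map_mul, map_zpow, map_one, T_ne _ _ hil.symm]
        · simp only [T_ne _ _ h1, T_ne _ _ h2]
  chain := by
    intro i j l hij hjl hil a b
    have hj := of_mem_S hij.symm
    have hl := of_mem_S hil.symm
    have hl' := of_mem_S hjl.symm
    rw [← QuotientGroup.mk_mul]
    have h3 : ∀ m, m ≠ i → T j 1 (of l ^ b) (of m) ∈ S i := by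
      intro m hm
      by_cases hmk : m = j
      · subst hmk; rw [T_self (one_mem _) (zpow_mem hl' _), one_mul]
        exact mul_mem (of_mem_S hm) (zpow_mem hl _)
      · rw [T_ne _ _ hmk]; exact of_mem_S hm
    have h4 : T j 1 (of l ^ b) (of j ^ a) = (of j * of l ^ b) ^ a := by
      rw [map_zpow, T_self (one_mem _) (zpow_mem hl' _), one_mul]
    rw [T_conj (one_mem _) (zpow_mem hj _) _ (T_ne _ _ hij) h3, map_one, h4, QuotientGroup.mk_mul,
      ← QuotientGroup.mk_mul, ← QuotientGroup.mk_mul]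
    rw [T_mul (one_mem _) (zpow_mem hj _) (one_mem _) (zpow_mem hl _), QuotientGroup.mk_mul]
    congr 1
    apply T_congr (one_mem _) (zpow_mem (mul_mem hj (zpow_mem hl _)) _) (mul_mem (one_mem _) (one_mem _))
      (mul_mem (zpow_mem hj _) (zpow_mem hl _))
    simp only [one_mul, map_mul, map_zpow, mul_zpow]
    rw [← zpow_mul, mul_comm b a]
  rot := by
    intro i j hij
    have hj := of_mem_S hij.symm
    have hi := of_mem_S hij
    have e1 : (QuotientGroup.mk (T j 1 (of i ^ (1:ℤ))) : MulAut (FreeGroup ι) ⧸ Γ ι) =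
        QuotientGroup.mk (T j (of i) 1) := by
      apply T_congr (one_mem _) (zpow_mem hi _) hi (one_mem _); simp
    have e2 : (QuotientGroup.mk (T i 1 (of j ^ (-1:ℤ))) : MulAut (FreeGroup ι) ⧸ Γ ι) =
        QuotientGroup.mk (T i (of j)⁻¹ 1) := by
      apply T_congr (one_mem _) (zpow_mem hj _) (inv_mem hj) (one_mem _); simp
    refine ⟨T j (of i) 1 * T i (of j)⁻¹ 1 * T j 1 (of i), ?_, ?_⟩
    · refine ⟨Equiv.swap i j, fun k => if k = i then -1 else 1, ?_, ?_⟩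
      · intro k; by_cases h : k = i <;> simp [h]
      · intro m
        simp only [MulAut.mul_apply]
        by_cases h1 : m = i
        · subst h1
          simp [T_self hi (one_mem _), T_self (inv_mem hj) (one_mem _), T_self (one_mem _) hi, T_ne _ _ hij,
            T_ne _ _ hij.symm]
        · by_cases h2 : m = j
          · subst h2
            simp [T_self hi (one_mem _), T_self (inv_mem hj) (one_mem _), T_self (one_mem _) hi, T_ne _ _ hij,
              T_ne _ _ hij.symm, h1]
          · simp [T_ne _ _ h1, T_ne _ _ h2, Equiv.swap_apply_of_ne_of_ne h1 h2, h1]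
    · rw [e2]
      conv_rhs => rw [e1]
      simp only [QuotientGroup.coe_mk', QuotientGroup.mk_mul]
      rw [← e1, zpow_one]
  flip := by
    intro i
    refine ⟨_, ⟨flipAut i, flip_mem i, rfl⟩, ?_⟩
    intro v
    change act _ v = _
    unfold act
    ext j
    simp only [flip_zpow, abv_zpow, abv_of, Finset.sum_apply, Pi.smul_apply, Pi.single_apply]
    rw [Finset.sum_eq_single j]
    · by_cases h : j = i
      · subst h; simp
      · simp [h]
    · intro b _ hb; simp [Ne.symm hb]
    · simp
  hW := by
    rintro _ ⟨φ, ⟨σ, ε, h1, h2⟩, rfl⟩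
    refine ⟨σ, ε, h1, ?_, ?_⟩
    · intro v i
      change act _ v _ = _
      unfold act
      simp only [h2, abv_zpow, abv_of, Finset.sum_apply, Pi.smul_apply, Pi.single_apply]
      rw [Finset.sum_eq_single i]
      · simp; ring
      · intro b _ hb; simp [(σ.injective.ne hb).symm]
      · simp
    · intro i j a hij
      have hj := of_mem_S hij.symm
      obtain ⟨h3, h4, h5⟩ := SP_conj h1 h2 (one_mem _) (zpow_mem hj a)
      rw [QuotientGroup.mk'_apply, ← QuotientGroup.mk_mul]
      have hσj : of (σ j) ∈ S (σ i) := of_mem_S (σ.injective.ne hij.symm)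
      have e : φ (of j ^ a) = of (σ j) ^ (ε j * a) := by rw [map_zpow, h2, ← zpow_mul]
      rw [e] at h4 h5
      rcases h5 with ⟨h, h5⟩ | ⟨h, h5⟩
      · rw [h5, QuotientGroup.mk_mul, h, one_mul, map_one]
      · rw [h5, QuotientGroup.mk_mul, h]
        congr 1
        apply T_congr (inv_mem h4) (inv_mem h3) (one_mem _) (zpow_mem hσj _)
        simp
  injW := by
    rintro _ ⟨φ, ⟨σ, ε, h1, h2⟩, rfl⟩ h
    have h3 : ∀ i, ε i • (Pi.single (σ i) 1 : ι → ℤ) = Pi.single i 1 := by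
      intro i
      have h4 : act φ (Pi.single i 1) = Pi.single i 1 := by
        have := Equiv.congr_fun h (Pi.single i 1)
        exact this
      rw [act_single, h2, abv_zpow, abv_of] at h4
      exact h4
    have h5 : φ = 1 := by
      apply aut_ext
      intro i
      have h6 := congrFun (h3 i) i
      by_cases h7 : i = σ i
      · simp [Pi.single_apply, ← h7] at h6
        rw [h2, ← h7, h6]; simp
      · simp [Pi.single_apply, h7] at h6
    rw [h5]; rfl

theorem mem_Γ_of {φ : MulAut (FreeGroup ι)} (h : ∀ i, abv (φ (of i)) = abv (of i)) : φ ∈ Γ ι := by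
  have hinj := (glData ι).injective (by
    have : ((glData ι).H ∅).comap (QuotientGroup.mk' (Γ ι)) = ⊤ := by
      apply gen_top
      · intro w hw
        apply Subgroup.subset_closure
        right
        exact ⟨⟨w, hw, rfl⟩, by simp⟩
      · intro k l hkl
        apply Subgroup.subset_closure
        left
        refine ⟨k, l, 1, by simp, hkl, ?_⟩
        change _ = QuotientGroup.mk _
        rw [zpow_one]; rfl
    rw [eq_top_iff]
    intro x _
    obtain ⟨φ, rfl⟩ := QuotientGroup.mk'_surjective (Γ ι) x
    have h : φ ∈ ((glData ι).H ∅).comap (QuotientGroup.mk' (Γ ι)) := by rw [this]; trivial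
    exact h)
  rw [← QuotientGroup.eq_one_iff]
  apply hinj
  rw [map_one]
  exact act_eq_one h

end IAGen


namespace IAGen

open FreeGroup (of)
open scoped commutatorElement

set_option linter.unusedSectionVars false
set_option linter.unusedVariables false
set_option linter.unusedSimpArgs false

variable {ι : Type} [DecidableEq ι]

/-- A Heisenberg type group. -/
@[ext] structure Heis (ι : Type) where
  v : ι → ℤ
  m : ι → ι → ℤ

instance : Mul (Heis ι) := ⟨fun x y => ⟨x.v + y.v, fun p q => x.m p q + y.m p q + x.v p * y.v q⟩⟩
instance : One (Heis ι) := ⟨⟨0, fun _ _ => 0⟩⟩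
instance : Inv (Heis ι) := ⟨fun x => ⟨-x.v, fun p q => - x.m p q + x.v p * x.v q⟩⟩

lemma heis_mul_v (x y : Heis ι) (p : ι) : (x * y).v p = x.v p + y.v p := rfl
lemma heis_mul_m (x y : Heis ι) (p q : ι) : (x * y).m p q = x.m p q + y.m p q + x.v p * y.v q := rfl
lemma heis_one_v (p : ι) : (1 : Heis ι).v p = 0 := rfl
lemma heis_one_m (p q : ι) : (1 : Heis ι).m p q = 0 := rfl
lemma heis_inv_v (x : Heis ι) (p : ι) : (x⁻¹).v p = - x.v p := rfl
lemma heis_inv_m (x : Heis ι) (p q : ι) : (x⁻¹).m p q = - x.m p q + x.v p * x.v q := rfl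

instance : Group (Heis ι) := Group.ofLeftAxioms
  (by
    intro x y z
    ext p
    · simp only [heis_mul_v]; ring
    · simp only [heis_mul_v, heis_mul_m]; ring)
  (by
    intro x
    ext p
    · simp only [heis_mul_v, heis_one_v]; ring
    · simp only [heis_mul_m, heis_one_v, heis_one_m]; ring)
  (by
    intro x
    ext p
    · simp only [heis_mul_v, heis_one_v, heis_inv_v]; ring
    · simp only [heis_mul_m, heis_inv_v, heis_one_m, heis_inv_m]; ring)

def θ (ι : Type) [DecidableEq ι] : FreeGroup ι →* Heis ι :=
  FreeGroup.lift (fun i => ⟨Pi.single i 1, fun _ _ => 0⟩)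

def μ (g : FreeGroup ι) (p q : ι) : ℤ := (θ ι g).m p q

lemma θ_v (g : FreeGroup ι) (p : ι) : (θ ι g).v p = abv g p := by
  induction g using FreeGroup.induction_on with
  | C1 => rw [map_one, abv_one]; rfl
  | of k => simp [θ, abv_of]
  | inv_of k h => rw [map_inv, abv_inv, heis_inv_v, h]; rfl
  | mul x y hx hy => rw [map_mul, abv_mul, heis_mul_v, hx, hy]; rfl

lemma μ_mul (g h : FreeGroup ι) (p q : ι) : μ (g * h) p q = μ g p q + μ h p q + abv g p * abv h q := by
  unfold μ
  rw [map_mul, heis_mul_m, θ_v, θ_v]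

lemma μ_one (p q : ι) : μ (1 : FreeGroup ι) p q = 0 := by
  unfold μ; rw [map_one]; rfl

lemma μ_inv (g : FreeGroup ι) (p q : ι) : μ g⁻¹ p q = - μ g p q + abv g p * abv g q := by
  unfold μ
  rw [map_inv, heis_inv_m, θ_v, θ_v]

lemma μ_of (i p q : ι) : μ (of i) p q = 0 := by
  simp [μ, θ]

lemma μ_K (i j p q : ι) : μ (of j * of i * (of j)⁻¹) p q =
    (if p = j ∧ q = i then 1 else 0) - (if p = i ∧ q = j then 1 else 0) := by
  simp only [μ_mul, μ_inv, μ_of, abv_mul, abv_inv, abv_of, Pi.add_apply, Pi.neg_apply, Pi.single_apply]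
  split_ifs <;> simp_all

lemma μ_M (i j k p q : ι) : μ (1 * of i * ⁅of j, of k⁆) p q =
    (if p = j ∧ q = k then 1 else 0) - (if p = k ∧ q = j then 1 else 0) := by
  simp only [commutatorElement_def, μ_mul, μ_inv, μ_of, μ_one, abv_one, abv_mul, abv_inv, abv_of, Pi.add_apply, Pi.neg_apply, Pi.single_apply]
  split_ifs <;> simp_all

variable [LinearOrder ι]

lemma Γ_ab {φ : MulAut (FreeGroup ι)} (h : φ ∈ Γ ι) :
    ∀ g, Abelianization.of (φ g) = Abelianization.of g := by
  have key : ∀ φ : MulAut (FreeGroup ι), (∀ k, Abelianization.of (φ (of k)) = Abelianization.of (of k)) →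
      ∀ g, Abelianization.of (φ g) = Abelianization.of g := by
    intro φ hφ g
    have : (Abelianization.of).comp φ.toMonoidHom = Abelianization.of := by
      ext k; exact hφ k
    exact DFunLike.congr_fun this g
  induction h using Subgroup.closure_induction with
  | mem x hx =>
    apply key
    intro m
    rcases hx with ⟨i, j, hij, rfl⟩ | ⟨i, j, k, hij, hik, hjk, rfl⟩
    · by_cases h : m = i
      · subst h
        rw [T_self (of_mem_S hij.symm) (inv_mem (of_mem_S hij.symm))]
        simp
      · rw [T_ne _ _ h]
    · by_cases h : m = i
      · subst h
        rw [T_self (one_mem _) (comm_S hij hik), map_mul, comm_ab]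
        simp
      · rw [T_ne _ _ h]
  | one => intro g; rfl
  | mul x y _ _ hx hy => intro g; rw [MulAut.mul_apply, hx, hy]
  | inv x _ hx => intro g; rw [← hx (x⁻¹ g), MulAut.apply_inv_self]

abbrev B (ι : Type) [LinearOrder ι] : Type := ι × {p : ι × ι // p.1 < p.2}

/-- the derivation -/
def dd (φ : Γ ι) (p q : ι) : FreeGroup ι →* Multiplicative ℤ where
  toFun g := Multiplicative.ofAdd (μ (φ.1 g) p q - μ g p q)
  map_one' := by simp
  map_mul' g h := by
    rw [map_mul, μ_mul, μ_mul, abv_eq (Γ_ab φ.2 g), abv_eq (Γ_ab φ.2 h), ← ofAdd_add]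
    congr 1; ring

lemma dd_apply (φ : Γ ι) (p q : ι) (ψ : Γ ι) (g : FreeGroup ι) : dd φ p q (ψ.1 g) = dd φ p q g := by
  have h1 : ∀ x, dd φ p q x = Abelianization.lift (dd φ p q) (Abelianization.of x) := fun x => by
    rw [Abelianization.lift_apply_of]
  rw [h1, h1 g, Γ_ab ψ.2]

def J (ι : Type) [DecidableEq ι] [LinearOrder ι] : Γ ι →* Multiplicative (B ι → ℤ) where
  toFun φ := Multiplicative.ofAdd (fun b => μ (φ.1 (of b.1)) b.2.1.1 b.2.1.2)
  map_one' := by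
    rw [← ofAdd_zero]; congr 1; ext b
    exact μ_of _ _ _
  map_mul' φ ψ := by
    rw [← ofAdd_add]; congr 1; ext b
    have h := dd_apply φ b.2.1.1 b.2.1.2 ψ (of b.1)
    have h2 : μ (φ.1 (ψ.1 (of b.1))) b.2.1.1 b.2.1.2 - μ (ψ.1 (of b.1)) b.2.1.1 b.2.1.2 =
      μ (φ.1 (of b.1)) b.2.1.1 b.2.1.2 - μ (of b.1) b.2.1.1 b.2.1.2 := h
    rw [μ_of] at h2
    change μ (φ.1 (ψ.1 (of b.1))) b.2.1.1 b.2.1.2 = μ (φ.1 (of b.1)) b.2.1.1 b.2.1.2 + μ (ψ.1 (of b.1)) b.2.1.1 b.2.1.2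
    linarith

lemma M_mem {i j k : ι} (h1 : i ≠ j) (h2 : i ≠ k) (h3 : j < k) : T i 1 ⁅of j, of k⁆ ∈ Γ ι :=
  Subgroup.subset_closure (Or.inr ⟨i, j, k, h1, h2, h3, rfl⟩)

lemma J_K {i j : ι} (h : i ≠ j) (b : B ι) : Multiplicative.toAdd (J ι ⟨_, K_mem h⟩) b =
    if b.1 = i then (if b.2.1.1 = j ∧ b.2.1.2 = i then 1 else 0) -
      (if b.2.1.1 = i ∧ b.2.1.2 = j then 1 else 0) else 0 := by
  change μ (T i (of j) (of j)⁻¹ (of b.1)) b.2.1.1 b.2.1.2 = _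
  by_cases hb : b.1 = i
  · rw [hb, T_self (of_mem_S h.symm) (inv_mem (of_mem_S h.symm)), μ_K]; simp
  · rw [T_ne _ _ hb, μ_of]; simp [hb]

lemma J_M {i j k : ι} (h1 : i ≠ j) (h2 : i ≠ k) (h3 : j < k) (b : B ι) :
    Multiplicative.toAdd (J ι ⟨_, M_mem h1 h2 h3⟩) b =
    if b.1 = i then (if b.2.1.1 = j ∧ b.2.1.2 = k then 1 else 0) -
      (if b.2.1.1 = k ∧ b.2.1.2 = j then 1 else 0) else 0 := by
  change μ (T i 1 ⁅of j, of k⁆ (of b.1)) b.2.1.1 b.2.1.2 = _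
  by_cases hb : b.1 = i
  · rw [hb, T_self (one_mem _) (comm_S h1 h2), μ_M]; simp
  · rw [T_ne _ _ hb, μ_of]; simp [hb]

/-- chosen generators, dual to `J` -/
lemma exists_u (b : B ι) : ∃ u : Γ ι, Multiplicative.toAdd (J ι u) = Pi.single b 1 ∧
    (∀ h : b.1 ≠ b.2.1.1 ∧ b.1 ≠ b.2.1.2, u = ⟨_, M_mem h.1 h.2 b.2.2⟩) ∧
    (∀ h : b.1 = b.2.1.1, u = (⟨_, K_mem (h ▸ b.2.2.ne)⟩ : Γ ι)⁻¹) ∧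
    (∀ h : b.1 = b.2.1.2, u = ⟨_, K_mem (h ▸ b.2.2.ne')⟩) := by
  obtain ⟨i, ⟨⟨p, q⟩, hpq⟩⟩ := b
  simp only at hpq
  by_cases h1 : i = p
  · subst h1
    refine ⟨(⟨_, K_mem hpq.ne⟩ : Γ ι)⁻¹, ?_, fun h => absurd rfl h.1, fun _ => rfl, fun h => absurd h hpq.ne⟩
    ext ⟨i', ⟨⟨p', q'⟩, hpq'⟩⟩
    rw [map_inv, toAdd_inv, Pi.neg_apply, J_K hpq.ne]
    simp only at hpq'
    simp only [Pi.single_apply, Prod.mk.injEq, Subtype.mk.injEq]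
    have : ¬ (p' = q ∧ q' = i) := by rintro ⟨rfl, rfl⟩; exact lt_asymm hpq hpq'
    simp only [this, if_false]
    split_ifs <;> simp_all
  · by_cases h2 : i = q
    · subst h2
      refine ⟨(⟨_, K_mem hpq.ne'⟩ : Γ ι), ?_, fun h => absurd rfl h.2, fun h => absurd h h1, fun _ => rfl⟩
      ext ⟨i', ⟨⟨p', q'⟩, hpq'⟩⟩
      rw [J_K hpq.ne']
      simp only at hpq'
      simp only [Pi.single_apply, Prod.mk.injEq, Subtype.mk.injEq]
      have : ¬ (p' = i ∧ q' = p) := by rintro ⟨rfl, rfl⟩; exact lt_asymm hpq hpq'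
      simp only [this, if_false]
      split_ifs <;> simp_all
    · refine ⟨⟨_, M_mem h1 h2 hpq⟩, ?_, fun _ => rfl, fun h => absurd h h1, fun h => absurd h h2⟩
      ext ⟨i', ⟨⟨p', q'⟩, hpq'⟩⟩
      rw [J_M h1 h2 hpq]
      simp only at hpq'
      simp only [Pi.single_apply, Prod.mk.injEq, Subtype.mk.injEq]
      have : ¬ (p' = q ∧ q' = p) := by rintro ⟨rfl, rfl⟩; exact lt_asymm hpq hpq'
      simp only [this, if_false]
      split_ifs <;> simp_all

variable [Fintype ι]

theorem iso (ι : Type) [DecidableEq ι] [LinearOrder ι] [Fintype ι] :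
    Nonempty ((B ι → ℤ) ≃ₗ[ℤ] Additive (Abelianization (Γ ι))) := by
  choose u hu h1 h2 h3 using fun b : B ι => exists_u b
  let s : (B ι → ℤ) →ₗ[ℤ] Additive (Abelianization (Γ ι)) :=
    Fintype.linearCombination ℤ (fun b => Additive.ofMul (Abelianization.of (u b)))
  let f : Additive (Abelianization (Γ ι)) →+ (B ι → ℤ) :=
    MonoidHom.toAdditiveLeft (Abelianization.lift (J ι))
  have hf : ∀ b, f (Additive.ofMul (Abelianization.of (u b))) = Pi.single b 1 := by
    intro b
    rw [← hu]
    change Multiplicative.toAdd (Abelianization.lift (J ι) (Abelianization.of (u b))) = _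
    rw [Abelianization.lift_apply_of]
  have hs : ∀ b, s (Pi.single b 1) = Additive.ofMul (Abelianization.of (u b)) := by
    intro b
    simp [s]
  have hfs : ∀ c, f (s c) = c := by
    intro c
    change f (Fintype.linearCombination ℤ _ c) = c
    rw [Fintype.linearCombination_apply, map_sum]
    simp only [map_zsmul, hf]
    ext b
    simp [Finset.sum_apply, Pi.single_apply]
  have hsurj : Function.Surjective s := by
    let R : Subgroup (Γ ι) := (AddSubgroup.toSubgroup' s.toAddMonoidHom.range).comap Abelianization.of
    have hR : ∀ g : Γ ι, g ∈ R ↔ ∃ c, s c = Additive.ofMul (Abelianization.of g) := fun g => Iff.rfl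
    have hu' : ∀ b, u b ∈ R := fun b => (hR _).mpr ⟨_, hs b⟩
    have htop : R = ⊤ := by
      rw [eq_top_iff]
      refine le_trans (Subgroup.closure_closure_coe_preimage (k := ({g | ∃ i j, i ≠ j ∧ g = T i (of j) (of j)⁻¹} ∪
        {g | ∃ i j k, i ≠ j ∧ i ≠ k ∧ j < k ∧ g = T i 1 ⁅of j, of k⁆} : Set (MulAut (FreeGroup ι))))).ge ?_
      refine (Subgroup.closure_le (G := Γ ι) R).mpr ?_
      rintro ⟨g, hg⟩ (⟨i, j, hij, e⟩ | ⟨i, j, k, hij, hik, hjk, e⟩)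
      · simp only at e
        subst e
        rcases lt_or_gt_of_ne hij with h | h
        · have := inv_mem (hu' (i, ⟨(i, j), h⟩))
          rw [h2 (i, ⟨(i, j), h⟩) rfl, inv_inv] at this
          exact this
        · have := (hu' (i, ⟨(j, i), h⟩))
          rw [h3 (i, ⟨(j, i), h⟩) rfl] at this
          exact this
      · simp only at e
        subst e
        have := (hu' (i, ⟨(j, k), hjk⟩))
        rw [h1 (i, ⟨(j, k), hjk⟩) ⟨hij, hik⟩] at this
        exact this
    intro x
    obtain ⟨g, hg⟩ := QuotientGroup.mk_surjective (Additive.toMul x)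
    have : g ∈ R := by rw [htop]; trivial
    obtain ⟨c, hc⟩ := (hR g).mp this
    exact ⟨c, hc.trans hg⟩
  exact ⟨LinearEquiv.ofBijective s ⟨fun a b h => by rw [← hfs a, ← hfs b, h], hsurj⟩⟩

lemma card_B (n : ℕ) : Fintype.card (B (Fin n)) = n * n.choose 2 := by
  rw [Fintype.card_prod, Fintype.card_fin]
  congr 1
  rw [Fintype.card_subtype]
  have : (Finset.univ.filter fun p : Fin n × Fin n => p.1 < p.2).card = ∑ q : Fin n, (q : ℕ) := by
    rw [Finset.card_filter, Fintype.sum_prod_type_right]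
    apply Finset.sum_congr rfl
    intro q _
    rw [← Finset.card_filter, ← Fin.card_Iio q]
    congr 1
    ext; simp
  rw [this, Fin.sum_univ_eq_sum_range (fun i => i), Finset.sum_range_id, Nat.choose_two_right]

end IAGen

lemma IA_eq_Γ (n : ℕ) : IA n = IAGen.Γ (Fin n) := by
  apply le_antisymm
  · intro φ hφ
    apply IAGen.mem_Γ_of
    intro i
    apply IAGen.abv_eq
    have h : φ.abelianizationCongr = 1 := hφ
    have h2 := DFunLike.congr_fun h (Abelianization.of (FreeGroup.of i))
    rwa [abelianizationCongr_of] at h2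
  · intro φ hφ
    change φ.abelianizationCongr = 1
    ext x
    refine QuotientGroup.induction_on x fun g => ?_
    change φ.abelianizationCongr (Abelianization.of g) = Abelianization.of g
    rw [abelianizationCongr_of]
    exact IAGen.Γ_ab hφ g

/-- `H_1(IA_n; ℤ)`, i.e. the abelianization of `IA_n`, is isomorphic to the abelian group
`Hom_ℤ(ℤ^n, Λ²(ℤ^n))` of `ℤ`-linear maps from `ℤ^n` to the second exterior power of `ℤ^n`. -/
theorem abelianization_IA_iso_hom_exteriorPower (n : ℕ) :
    Nonempty (Additive (Abelianization (IA n)) ≃+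
      ((Fin n → ℤ) →ₗ[ℤ] ↥(⋀[ℤ]^2 (Fin n → ℤ)))) := by
  rw [IA_eq_Γ]
  obtain ⟨e⟩ := IAGen.iso (Fin n)
  have hfr : Module.finrank ℤ (IAGen.B (Fin n) → ℤ) =
      Module.finrank ℤ ((Fin n → ℤ) →ₗ[ℤ] ↥(⋀[ℤ]^2 (Fin n → ℤ))) := by
    rw [Module.finrank_linearMap, exteriorPower.finrank_eq, Module.finrank_fintype_fun_eq_card,
      Module.finrank_fintype_fun_eq_card, IAGen.card_B, Fintype.card_fin]
  exact ⟨(e.symm.trans (LinearEquiv.ofFinrankEq _ _ hfr)).toAddEquiv⟩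
end
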